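/- arXiv:2308.12268 — 4 statements merged into one kernel-verified Lean document; each statement's English description precedes it below -/
import Mathlib

section
/- Let r, n ≥ 1 and let P be any r-partite r-pattern. Then ex_<(n, P) = C(n,r) − C((n−r)_+, r), where C(a,b) denotes the binomial coefficient. -/
/-- An ordered `r`-matching of size `n`: a partition of `{1,…,r*n}` into `n`
edges, each of size `r`. -/
def IsOrderedMatching (r n : ℕ) (M : Finset (Finset ℕ)) : Prop :=
  M.card = n ∧ (∀ e ∈ M, e.card = r) ∧
    (∀ e ∈ M, ∀ f ∈ M, e ≠ f → Disjoint e f) ∧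
    M.biUnion id = Finset.Icc 1 (r * n)

/-- Two edges `e, f` form the pattern `P`: there is a strictly increasing map
on `e ∪ f` sending the pair `{e, f}` to the pair of edges of `P`. -/
def FormsPattern (e f : Finset ℕ) (P : Finset (Finset ℕ)) : Prop :=
  ∃ φ : ℕ → ℕ, StrictMonoOn φ (↑(e ∪ f) : Set ℕ) ∧
    ({e.image φ, f.image φ} : Finset (Finset ℕ)) = P

/-- An `r`-pattern: an ordered `r`-matching of size `2` (on `{1,…,2r}`). -/
def IsPattern (r : ℕ) (P : Finset (Finset ℕ)) : Prop :=
  IsOrderedMatching r 2 P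

/-- A collection of edges in which every pair of distinct edges forms `P`. -/
def IsPatternClique (P S : Finset (Finset ℕ)) : Prop :=
  ∀ e ∈ S, ∀ f ∈ S, e ≠ f → FormsPattern e f P

/-- `L_P(M)`: the maximum size of a sub-matching of `M` which is a `P`-clique. -/
noncomputable def cliqueSize (P M : Finset (Finset ℕ)) : ℕ :=
  sSup {k | ∃ S ⊆ M, IsPatternClique P S ∧ S.card = k}

/-- `L(M) = max_P L_P(M)`, the maximum over all `r`-patterns `P`. -/
noncomputable def Lmax (r : ℕ) (M : Finset (Finset ℕ)) : ℕ :=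
  sSup {k | ∃ P, IsPattern r P ∧ cliqueSize P M = k}

/-- An ordered `r`-matching on `{1,…,r*n}` is `r`-partite if, dividing the
vertex set into `r` contiguous intervals of length `n`, every edge has exactly
one vertex in each interval. -/
def IsPartite (r n : ℕ) (M : Finset (Finset ℕ)) : Prop :=
  ∀ e ∈ M, ∀ i : ℕ, 1 ≤ i → i ≤ r →
    (e ∩ Finset.Icc ((i - 1) * n + 1) (i * n)).card = 1

/-- An ordered `r`-graph on the vertex set `{1,…,n}`: every edge has `r`
vertices, drawn from `{1,…,n}`. -/
def IsOrderedGraph (r n : ℕ) (G : Finset (Finset ℕ)) : Prop :=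
  ∀ e ∈ G, e.card = r ∧ e ⊆ Finset.Icc 1 n

/-- `G` contains a subgraph order-isomorphic to `F`: there is a strictly
increasing map on the vertices of `F` sending every edge of `F` to an edge
of `G`. -/
def ContainsCopy (G F : Finset (Finset ℕ)) : Prop :=
  ∃ φ : ℕ → ℕ, StrictMonoOn φ (↑(F.biUnion id) : Set ℕ) ∧ ∀ e ∈ F, e.image φ ∈ G

/-- `ex_<(n, F)`: the maximum number of edges in an `F`-free ordered `r`-graph
on `n` vertices. -/
noncomputable def exOrd (r n : ℕ) (F : Finset (Finset ℕ)) : ℕ :=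
  sSup {k | ∃ G, IsOrderedGraph r n G ∧ ¬ ContainsCopy G F ∧ G.card = k}

open Finset Classical in
/-- The members of `F` whose `j`-th coordinate can be replaced, inside `F`, by one with a larger
value of `g j`. -/
noncomputable def improvable {ι α β : Type*} [LT β] (g : ι → α → β) (j : ι)
    (F : Finset (ι → α)) : Finset (ι → α) :=
  F.filter fun x => ∃ v, g j (x j) < g j v ∧ Function.update x j v ∈ F

section Improvable

open Finset Classical

variable {ι α β : Type*} [LinearOrder β] {g : ι → α → β}

lemma mem_improvable {j : ι} {F : Finset (ι → α)} {x : ι → α} :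
    x ∈ improvable g j F ↔ x ∈ F ∧ ∃ v, g j (x j) < g j v ∧ Function.update x j v ∈ F := by
  simp only [improvable, mem_filter]

lemma improvable_subset (j : ι) (F : Finset (ι → α)) : improvable g j F ⊆ F :=
  fun _ hx => (mem_improvable.1 hx).1

lemma improvable_mono (j : ι) {F A : Finset (ι → α)} (h : F ⊆ A) :
    improvable g j F ⊆ improvable g j A := fun x hx => by
  obtain ⟨hF, v, hv, hu⟩ := mem_improvable.1 hx
  exact mem_improvable.2 ⟨h hF, v, hv, h hu⟩

lemma card_sdiff_improvable_le (hg : ∀ i, Function.Injective (g i)) (j : ι)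
    {F A : Finset (ι → α)} (h : F ⊆ A) :
    (F \ improvable g j F).card ≤ (A \ improvable g j A).card := by
  let ρ : (ι → α) → ({i // i ≠ j} → α) := fun x i => x i
  have hρ : ∀ x y, ρ x = ρ y → y = Function.update x j (y j) := by
    intro x y hxy
    funext i
    by_cases hi : i = j
    · subst hi; simp
    · simpa [hi] using (congrFun hxy ⟨i, hi⟩).symm
  have hinj : Set.InjOn ρ (F \ improvable g j F : Finset (ι → α)) := by
    intro x hx y hy hxy
    simp only [coe_sdiff, Set.mem_sdiff, mem_coe, mem_improvable, not_and, not_exists] at hx hy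
    rcases lt_trichotomy (g j (x j)) (g j (y j)) with hlt | heq | hlt
    · exact absurd (hρ x y hxy ▸ hy.1) (hx.2 hx.1 _ hlt)
    · rw [hρ x y hxy, ← hg j heq, Function.update_eq_self]
    · exact absurd (hρ y x hxy.symm ▸ hx.1) (hy.2 hy.1 _ hlt)
  rw [← card_image_of_injOn hinj]
  refine (card_le_card fun z hz => ?_).trans (card_image_le (f := ρ))
  obtain ⟨x, hx, rfl⟩ := mem_image.1 hz
  have hxA : x ∈ A := h (mem_sdiff.1 hx).1
  obtain ⟨y, hy, hmax⟩ := exists_max_image (A.filter fun y => ρ y = ρ x) (fun y => g j (y j))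
    ⟨x, by simp [hxA]⟩
  rw [mem_filter] at hy
  refine mem_image.2 ⟨y, mem_sdiff.2 ⟨hy.1, fun hmem => ?_⟩, hy.2⟩
  obtain ⟨-, v, hv, hu⟩ := mem_improvable.1 hmem
  have := hmax _ (mem_filter.2 ⟨hu, by
    rw [← hy.2]; funext i; simp [ρ, i.2]⟩)
  simp only [Function.update_self] at this
  exact absurd hv this.not_gt

lemma foldr_improvable_subset (L : List ι) (F : Finset (ι → α)) :
    L.foldr (improvable g) F ⊆ F := by
  induction L with
  | nil => simp
  | cons a L ih => exact (improvable_subset a _).trans ih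

lemma foldr_improvable_mono (L : List ι) {F A : Finset (ι → α)} (h : F ⊆ A) :
    L.foldr (improvable g) F ⊆ L.foldr (improvable g) A := by
  induction L with
  | nil => simpa
  | cons a L ih => exact improvable_mono a ih

lemma card_add_card_foldr_improvable_le (hg : ∀ i, Function.Injective (g i)) (L : List ι)
    {F A : Finset (ι → α)} (h : F ⊆ A) :
    F.card + (L.foldr (improvable g) A).card ≤ A.card + (L.foldr (improvable g) F).card := by
  induction L with
  | nil => simp [add_comm]
  | cons a L ih =>
    have h1 := card_sdiff_improvable_le hg a (foldr_improvable_mono (g := g) L h)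
    have h2 := card_sdiff_add_card_eq_card (improvable_subset (g := g) a (L.foldr (improvable g) A))
    have h3 := card_sdiff_add_card_eq_card (improvable_subset (g := g) a (L.foldr (improvable g) F))
    simp only [List.foldr_cons]
    omega

lemma mem_foldr_improvable_of_mixed {A : Finset (ι → α)} {x t : ι → α}
    (hlt : ∀ i, g i (x i) < g i (t i)) (hA : ∀ p : ι → α, (∀ i, p i = x i ∨ p i = t i) → p ∈ A)
    (L : List ι) (hL : L.Nodup) : x ∈ L.foldr (improvable g) A := by
  suffices H : ∀ p : ι → α, (∀ i, p i = x i ∨ p i = t i) → (∀ i ∈ L, p i = x i) →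
      p ∈ L.foldr (improvable g) A from H x (fun _ => Or.inl rfl) fun _ _ => rfl
  induction L with
  | nil => exact fun p hp _ => hA p hp
  | cons a L ih =>
    intro p hp hpL
    rw [List.nodup_cons] at hL
    refine mem_improvable.2 ⟨ih hL.2 p hp fun i hi => hpL i (by simp [hi]), t a, ?_, ?_⟩
    · rw [hpL a (by simp)]
      exact hlt a
    · refine ih hL.2 _ (fun i => ?_) fun i hi => ?_
      · by_cases hi : i = a
        · subst hi; simp
        · simpa [hi] using hp i
      · have hia : i ≠ a := fun h => hL.1 (h ▸ hi)
        simpa [hia] using hpL i (by simp [hi])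

lemma exists_of_mem_foldr_improvable [Preorder ι] [Preorder α] {F : Finset (ι → α)}
    (hF : ∀ x ∈ F, StrictMono x) (L : List ι) (hL : L.Nodup) {x : ι → α}
    (hx : x ∈ L.foldr (improvable g) F) :
    ∃ y ∈ F, (∀ i ∈ L, g i (x i) < g i (y i)) ∧ (∀ i ∉ L, y i = x i) ∧
      L.Pairwise fun a b => (a < b → y a < x b) ∧ (b < a → x b < y a) := by
  induction L generalizing x with
  | nil => exact ⟨x, hx, by simp, by simp, List.Pairwise.nil⟩
  | cons a L ih =>
    rw [List.nodup_cons] at hL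
    obtain ⟨-, v, hv, hu⟩ := mem_improvable.1 hx
    obtain ⟨y, hy, h1, h2, h3⟩ := ih hL.2 hu
    have hne : ∀ b ∈ L, b ≠ a := fun b hb h => hL.1 (h ▸ hb)
    have hya : y a = v := by simpa using h2 a hL.1
    have hmono := hF _ (foldr_improvable_subset L F hu)
    refine ⟨y, hy, ?_, ?_, ?_⟩
    · intro i hi
      rcases List.mem_cons.1 hi with rfl | hi
      · rwa [hya]
      · simpa [hne i hi] using h1 i hi
    · intro i hi
      rw [List.mem_cons, not_or] at hi
      simpa [hi.1] using h2 i hi.2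
    · refine List.pairwise_cons.2 ⟨fun b hb => ⟨fun hab => ?_, fun hba => ?_⟩, ?_⟩
      · simpa [hne b hb, hya] using hmono hab
      · simpa [hne b hb, hya] using hmono hba
      · refine h3.imp_of_mem fun {c b} _ hb h => ?_
        simpa [hne b hb] using h

end Improvable

section MonotoneTuples

open Finset Classical

/-- The strictly increasing `r`-tuples with entries in `{1,…,n}`. -/
noncomputable def increasingTuples (r n : ℕ) : Finset (Fin r → ℕ) :=
  (Fintype.piFinset fun _ => Icc 1 n).filter StrictMono

lemma mem_increasingTuples {r n : ℕ} {x : Fin r → ℕ} :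
    x ∈ increasingTuples r n ↔ (∀ i, 1 ≤ x i ∧ x i ≤ n) ∧ StrictMono x := by
  simp [increasingTuples]

lemma StrictMono.eq_of_image_univ_eq {r : ℕ} {x y : Fin r → ℕ} (hx : StrictMono x)
    (hy : StrictMono y) (h : univ.image x = univ.image y) : x = y := by
  refine (hx.range_inj hy).1 ?_
  have := congrArg (fun s : Finset ℕ => (s : Set ℕ)) h
  simpa using this

lemma image_univ_increasingTuples (r n : ℕ) :
    (increasingTuples r n).image (fun x => univ.image x) = powersetCard r (Icc 1 n) := by
  ext e
  simp only [mem_image, mem_increasingTuples, mem_powersetCard]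
  constructor
  · rintro ⟨x, ⟨h1, h2⟩, rfl⟩
    refine ⟨fun v hv => ?_, ?_⟩
    · obtain ⟨i, -, rfl⟩ := mem_image.1 hv
      exact mem_Icc.2 (h1 i)
    · rw [card_image_of_injective _ h2.injective]; simp
  · rintro ⟨h1, h2⟩
    refine ⟨e.orderEmbOfFin h2, ⟨fun i => mem_Icc.1 (h1 (e.orderEmbOfFin_mem h2 i)),
      (e.orderEmbOfFin h2).strictMono⟩, ?_⟩
    exact image_orderEmbOfFin_univ e h2

lemma injOn_image_univ_increasingTuples (r n : ℕ) :
    Set.InjOn (fun x : Fin r → ℕ => univ.image x) (increasingTuples r n) :=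
  fun _ hx _ hy h => (mem_increasingTuples.1 hx).2.eq_of_image_univ_eq
    (mem_increasingTuples.1 hy).2 h

lemma card_increasingTuples (r n : ℕ) : (increasingTuples r n).card = n.choose r := by
  rw [← card_image_of_injOn (injOn_image_univ_increasingTuples r n), image_univ_increasingTuples]
  simp

lemma add_two_mul_le_of_gap {r : ℕ} {m : Fin r → ℕ} (h : ∀ i k, i < k → m i + 2 ≤ m k)
    (i k : Fin r) (hik : i ≤ k) : m i + 2 * (k.1 - i.1) ≤ m k := by
  obtain ⟨k, hk⟩ := k
  induction k with
  | zero =>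
    have : i = ⟨0, hk⟩ := le_antisymm hik (Fin.mk_le_of_le_val (Nat.zero_le _))
    subst this; simp
  | succ k ih =>
    rcases hik.eq_or_lt with rfl | hlt
    · simp
    · have h1 : i ≤ ⟨k, by omega⟩ := Fin.le_def.2 (Nat.lt_succ_iff.1 (Fin.lt_def.1 hlt))
      have h2 := ih (by omega) h1
      have h3 := h ⟨k, by omega⟩ ⟨k + 1, hk⟩ (Fin.lt_def.2 (Nat.lt_succ_self k))
      have h4 : i.1 ≤ k := h1
      simp only at h2 ⊢
      omega

end MonotoneTuples

section SignedPairs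

open Finset Classical

/-- The tuples `x`, `y` interleave in `r` consecutive blocks, with `x i < y i` exactly when
`s i` holds. -/
def SignedInterleaved {r : ℕ} (s : Fin r → Prop) (x y : Fin r → ℕ) : Prop :=
  (∀ i, (s i → x i < y i) ∧ (¬ s i → y i < x i)) ∧ ∀ i k, i < k → max (x i) (y i) < min (x k) (y k)

/-- The tuple with `i`-th entry (0-based) `2i + 1` if `s i` holds and `2i + 2` otherwise. -/
noncomputable def blockTuple {r : ℕ} (s : Fin r → Prop) (i : Fin r) : ℕ :=
  2 * i + if s i then 1 else 2

/-- The family of tuples `x` for which moving each `x i` by one, up when `s i` holds and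
down otherwise, yields a signed interleaved pair inside `{1,…,n}`. -/
noncomputable def shiftableTuples {r : ℕ} (s : Fin r → Prop) (n : ℕ) : Finset (Fin r → ℕ) :=
  (increasingTuples r (n - r)).image fun d i => d i + i + if s i then 0 else 1

variable {r n : ℕ} {s : Fin r → Prop}

lemma card_shiftableTuples : (shiftableTuples s n).card = (n - r).choose r := by
  rw [shiftableTuples, card_image_of_injective, card_increasingTuples]
  intro d d' h
  funext i
  have := congrFun h i
  simp only at this
  omega

lemma shiftableTuples_subset_increasingTuples : shiftableTuples s n ⊆ increasingTuples r n := by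
  intro x hx
  obtain ⟨d, hd, rfl⟩ := mem_image.1 hx
  obtain ⟨h1, h2⟩ := mem_increasingTuples.1 hd
  refine mem_increasingTuples.2 ⟨fun i => ?_, fun i k hik => ?_⟩
  · have := h1 i
    have := i.2
    split_ifs <;> omega
  · have := h2 hik
    have := Fin.lt_def.1 hik
    dsimp only
    split_ifs <;> omega

lemma SignedInterleaved.mem_shiftableTuples {x y : Fin r → ℕ} (h : SignedInterleaved s x y)
    (hx : ∀ i, 1 ≤ x i ∧ x i ≤ n) (hy : ∀ i, 1 ≤ y i ∧ y i ≤ n) : x ∈ shiftableTuples s n := by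
  obtain ⟨h1, h2⟩ := h
  let m : Fin r → ℕ := fun i => x i - if s i then 0 else 1
  have hm : ∀ i, min (x i) (y i) ≤ m i ∧ m i + 1 ≤ max (x i) (y i) ∧
      x i = m i + if s i then 0 else 1 := by
    intro i
    by_cases hs : s i
    · have := (h1 i).1 hs
      simp only [m, hs, if_true]; omega
    · have := (h1 i).2 hs
      simp only [m, hs, if_false]; omega
  have hgap : ∀ i k, i < k → m i + 2 ≤ m k := fun i k hik => by
    have := h2 i k hik
    have := (hm i).2.1
    have := (hm k).1
    omega
  have hbound := add_two_mul_le_of_gap hgap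
  have hlow : ∀ i, 1 + 2 * i.1 ≤ m i := fun i => by
    have hr : 0 < r := i.pos
    have h3 := hbound ⟨0, hr⟩ i (Fin.le_def.2 (Nat.zero_le _))
    have := (hm ⟨0, hr⟩).1
    have := hx ⟨0, hr⟩
    have := hy ⟨0, hr⟩
    simp only at h3
    omega
  have hupp : ∀ i, m i + 1 + 2 * (r - 1 - i.1) ≤ n := fun i => by
    have hr : r - 1 < r := Nat.sub_lt i.pos one_pos
    have h3 := hbound i ⟨r - 1, hr⟩ (Fin.le_def.2 (Nat.le_sub_one_of_lt i.2))
    have := (hm ⟨r - 1, hr⟩).2.1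
    have := hx ⟨r - 1, hr⟩
    have := hy ⟨r - 1, hr⟩
    simp only at h3
    omega
  refine mem_image.2 ⟨fun i => m i - i, mem_increasingTuples.2 ⟨fun i => ?_, fun i k hik => ?_⟩, ?_⟩
  · have := hlow i
    have := hupp i
    have := i.2
    omega
  · have h3 := hbound i k hik.le
    have := hlow i
    have := Fin.lt_def.1 hik
    dsimp only
    omega
  · funext i
    have := hlow i
    have := (hm i).2.2
    dsimp only
    omega

lemma SignedInterleaved.strictMono {x y : Fin r → ℕ} (h : SignedInterleaved s x y) :
    StrictMono x := fun i k hik => by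
  have := h.2 i k hik
  omega

/-- The signed value on which the `i`-th coordinate is compared. -/
noncomputable def signedValue (s : Fin r → Prop) (i : Fin r) (v : ℕ) : ℤ :=
  if s i then v else -v

lemma signedValue_injective (i : Fin r) : Function.Injective (signedValue s i) := by
  intro a b h
  unfold signedValue at h
  split_ifs at h <;> omega

/-- The order in which coordinates are moved: first those going up, from left to right, then
those going down, from right to left. -/
noncomputable def moveOrder (s : Fin r → Prop) : List (Fin r) :=
  (List.finRange r).filter (fun i => s i) ++ ((List.finRange r).filter (fun i => ¬ s i)).reverse

lemma nodup_moveOrder : (moveOrder s).Nodup := by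
  refine List.Nodup.append ((List.nodup_finRange r).filter _)
    (List.nodup_reverse.2 ((List.nodup_finRange r).filter _)) ?_
  intro i hi hi'
  simp at hi hi'
  exact hi' hi

lemma mem_moveOrder (i : Fin r) : i ∈ moveOrder s := by
  by_cases h : s i <;> simp [moveOrder, h]

lemma shiftableTuples_subset_foldr_improvable :
    shiftableTuples s n ⊆
      (moveOrder s).foldr (improvable (signedValue s)) (increasingTuples r n) := by
  intro x hx
  obtain ⟨d, hd, rfl⟩ := mem_image.1 hx
  obtain ⟨h1, h2⟩ := mem_increasingTuples.1 hd
  refine mem_foldr_improvable_of_mixed (t := fun i => d i + i + if s i then 1 else 0)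
    (fun i => ?_) (fun p hp => ?_) _ nodup_moveOrder
  · by_cases hs : s i <;> simp only [signedValue, hs, if_true, if_false] <;> omega
  · have key : ∀ i, d i + i.1 ≤ p i ∧ p i ≤ d i + i.1 + 1 := fun i => by
      rcases hp i with h | h <;> rw [h] <;> split_ifs <;> omega
    refine mem_increasingTuples.2 ⟨fun i => ?_, fun i k hik => ?_⟩
    · have := key i
      have := h1 i
      have := i.2
      omega
    · have := key i
      have := key k
      have := h2 hik
      have := Fin.lt_def.1 hik
      omega

lemma List.Pairwise.rel_of_mem_of_lt {α : Type*} [LinearOrder α] {R : α → α → Prop} {l : List α}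
    (hR : l.Pairwise R) (hl : l.Pairwise (· < ·)) {a b : α} (ha : a ∈ l) (hb : b ∈ l)
    (hab : a < b) : R a b := by
  have h := (hR.and hl).imp (S := fun a b => (a < b → R a b) ∧ (b < a → R b a))
    fun h => ⟨fun _ => h.1, fun h' => absurd h' h.2.not_gt⟩
  have : Std.Symm fun a b => (a < b → R a b) ∧ (b < a → R b a) := ⟨fun _ _ h => ⟨h.2, h.1⟩⟩
  exact (h.forall ha hb hab.ne).1 hab

lemma exists_signedInterleaved_of_mem {F : Finset (Fin r → ℕ)} (hF : ∀ x ∈ F, StrictMono x)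
    {x : Fin r → ℕ} (hx : x ∈ (moveOrder s).foldr (improvable (signedValue s)) F) :
    ∃ y ∈ F, SignedInterleaved s x y := by
  obtain ⟨y, hy, h1, -, h3⟩ := exists_of_mem_foldr_improvable hF _ nodup_moveOrder hx
  have hxm := hF _ (foldr_improvable_subset _ _ hx)
  have hym := hF _ hy
  obtain ⟨hup, hdown, -⟩ := List.pairwise_append.1 h3
  rw [List.pairwise_reverse] at hdown
  have hsign : ∀ i, (s i → x i < y i) ∧ (¬ s i → y i < x i) := fun i => by
    have := h1 i (mem_moveOrder i)
    unfold signedValue at this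
    split_ifs at this with h <;> simp only [h, true_implies, false_implies, not_true_eq_false,
      not_false_eq_true, and_true, true_and] <;> omega
  refine ⟨y, hy, hsign, fun i k hik => ?_⟩
  have hfin := List.pairwise_lt_finRange r
  have hxik := hxm hik
  have hyik := hym hik
  by_cases hi : s i <;> by_cases hk : s k
  · have := (hup.rel_of_mem_of_lt (hfin.filter _) (a := i) (b := k) (by simp [hi])
      (by simp [hk]) hik).1 hik
    have := (hsign i).1 hi
    have := (hsign k).1 hk
    omega
  · have := (hsign i).1 hi
    have := (hsign k).2 hk
    omega
  · have := (hsign i).2 hi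
    have := (hsign k).1 hk
    omega
  · have := (hdown.rel_of_mem_of_lt (hfin.filter _) (a := i) (b := k) (by simp [hi])
      (by simp [hk]) hik).2 hik
    have := (hsign i).2 hi
    have := (hsign k).2 hk
    omega

lemma exists_eq_blockTuple_pair {P : Finset (Finset ℕ)} (hP : IsPattern r P)
    (hpart : IsPartite r 2 P) : ∃ s : Fin r → Prop,
      P = {univ.image (blockTuple s), univ.image (blockTuple fun i => ¬ s i)} := by
  obtain ⟨hcard, -, hdisj, hunion⟩ := hP
  obtain ⟨e, f, hef, rfl⟩ := card_eq_two.1 hcard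
  have hU : e ∪ f = Icc 1 (r * 2) := by simpa using hunion
  have hD : Disjoint e f := hdisj e (by simp) f (by simp) hef
  have hone : ∀ d ∈ ({e, f} : Finset (Finset ℕ)), ∀ i : Fin r,
      ¬ (2 * i.1 + 1 ∈ d ∧ 2 * i.1 + 2 ∈ d) := by
    rintro d hd i ⟨h1, h2⟩
    have h := hpart d hd (i + 1) (by omega) i.2
    have hsub : ({2 * i.1 + 1, 2 * i.1 + 2} : Finset ℕ) ⊆
        d ∩ Icc ((i.1 + 1 - 1) * 2 + 1) ((i.1 + 1) * 2) := by
      intro v hv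
      rw [mem_insert, mem_singleton] at hv
      rw [mem_inter, mem_Icc]
      rcases hv with rfl | rfl
      · exact ⟨h1, by omega, by omega⟩
      · exact ⟨h2, by omega, by omega⟩
    have := card_le_card hsub
    rw [h, card_pair (by omega)] at this
    omega
  have he := hone e (by simp)
  have hf := hone f (by simp)
  have hmem : ∀ v, 1 ≤ v → v ≤ r * 2 → v ∈ e ∨ v ∈ f := fun v h1 h2 => by
    rw [← mem_union, hU]; exact mem_Icc.2 ⟨h1, h2⟩
  have hnot : ∀ v, v ∈ e → v ∉ f := fun v h => disjoint_left.1 hD h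
  have hrange : ∀ v, v ∈ e ∨ v ∈ f → 1 ≤ v ∧ v ≤ r * 2 := fun v h => by
    rw [← mem_union, hU] at h; exact mem_Icc.1 h
  have hdecomp : ∀ v, v ∈ e ∨ v ∈ f → ∃ i : Fin r, v = 2 * i.1 + 1 ∨ v = 2 * i.1 + 2 := by
    intro v h
    have := hrange v h
    exact ⟨⟨(v - 1) / 2, by omega⟩, by dsimp only; omega⟩
  have hblock : ∀ i : Fin r, (2 * i.1 + 1 ∈ e ∧ 2 * i.1 + 2 ∉ e ∧ 2 * i.1 + 1 ∉ f ∧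
      2 * i.1 + 2 ∈ f) ∨ (2 * i.1 + 1 ∉ e ∧ 2 * i.1 + 2 ∈ e ∧ 2 * i.1 + 1 ∈ f ∧
      2 * i.1 + 2 ∉ f) := by
    intro i
    have := hmem (2 * i.1 + 1) (by omega) (by omega)
    have := hmem (2 * i.1 + 2) (by omega) (by omega)
    have := hnot (2 * i.1 + 1)
    have := hnot (2 * i.1 + 2)
    have := he i
    have := hf i
    tauto
  refine ⟨fun i => 2 * i.1 + 1 ∈ e, ?_⟩
  congr 1
  · ext v
    simp only [mem_image, mem_univ, true_and, blockTuple]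
    constructor
    · intro hv
      obtain ⟨i, rfl | rfl⟩ := hdecomp v (Or.inl hv)
      · exact ⟨i, by simp [hv]⟩
      · have : 2 * i.1 + 1 ∉ e := fun h => he i ⟨h, hv⟩
        exact ⟨i, by simp [this]⟩
    · rintro ⟨i, rfl⟩
      have := hblock i
      split_ifs <;> tauto
  · congr 1
    ext v
    simp only [mem_image, mem_univ, true_and, blockTuple]
    constructor
    · intro hv
      obtain ⟨i, rfl | rfl⟩ := hdecomp v (Or.inr hv)
      · have : 2 * i.1 + 1 ∉ e := fun h => hnot _ h hv
        exact ⟨i, by simp [this]⟩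
      · have : 2 * i.1 + 1 ∈ e := by
          have := hblock i
          tauto
        exact ⟨i, by simp [this]⟩
    · rintro ⟨i, rfl⟩
      have := hblock i
      split_ifs <;> tauto

lemma containsCopy_iff {G P : Finset (Finset ℕ)} (hP : IsPattern r P)
    (hs : P = {univ.image (blockTuple s), univ.image (blockTuple fun i => ¬ s i)}) :
    ContainsCopy G P ↔ ∃ x y : Fin r → ℕ,
      univ.image x ∈ G ∧ univ.image y ∈ G ∧ SignedInterleaved s x y := by
  unfold ContainsCopy
  rw [hP.2.2.2]
  have hmem : ∀ (t : Fin r → Prop) i, blockTuple t i ∈ (Icc 1 (r * 2) : Finset ℕ) := fun t i => by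
    have := i.2
    rw [mem_Icc, blockTuple]
    split_ifs <;> omega
  constructor
  · rintro ⟨φ, hφ, hG⟩
    refine ⟨φ ∘ blockTuple s, φ ∘ blockTuple fun i => ¬ s i, ?_, ?_, fun i => ⟨?_, ?_⟩, ?_⟩
    · rw [← image_image]; exact hG _ (by simp [hs])
    · rw [← image_image]; exact hG _ (by simp [hs])
    · exact fun h => hφ (hmem _ _) (hmem _ _) (by simp [blockTuple, h])
    · exact fun h => hφ (hmem _ _) (hmem _ _) (by simp [blockTuple, h])
    · intro i k hik
      have hlt : ∀ t t' : Fin r → Prop, φ (blockTuple t i) < φ (blockTuple t' k) := fun t t' =>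
        hφ (hmem _ _) (hmem _ _) (by
          have := Fin.lt_def.1 hik
          unfold blockTuple
          split_ifs <;> omega)
      simp only [Function.comp, lt_min_iff, max_lt_iff]
      exact ⟨⟨hlt _ _, hlt _ _⟩, hlt _ _, hlt _ _⟩
  · rintro ⟨x, y, hx, hy, hsign, hsep⟩
    let φ : ℕ → ℕ := fun v => if h : (v - 1) / 2 < r then
      if v % 2 = 1 then min (x ⟨_, h⟩) (y ⟨_, h⟩) else max (x ⟨_, h⟩) (y ⟨_, h⟩) else 0
    have hφodd : ∀ i : Fin r, φ (2 * i.1 + 1) = min (x i) (y i) := fun i => by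
      have h1 : (2 * i.1 + 1 - 1) / 2 = i.1 := by omega
      have h2 : (2 * i.1 + 1) % 2 = 1 := by omega
      simp only [φ, h1, h2, i.2, dif_pos, if_true]
    have hφeven : ∀ i : Fin r, φ (2 * i.1 + 2) = max (x i) (y i) := fun i => by
      have h1 : (2 * i.1 + 2 - 1) / 2 = i.1 := by omega
      have h2 : ¬ (2 * i.1 + 2) % 2 = 1 := by omega
      simp only [φ, h1, h2, i.2, dif_pos, if_false]
    have hφx : φ ∘ blockTuple s = x := by
      funext i
      by_cases h : s i
      · have := (hsign i).1 h
        simp only [Function.comp, blockTuple, h, if_true, hφodd]; omega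
      · have := (hsign i).2 h
        simp only [Function.comp, blockTuple, h, if_false, hφeven]; omega
    have hφy : (φ ∘ blockTuple fun i => ¬ s i) = y := by
      funext i
      by_cases h : s i
      · have := (hsign i).1 h
        simp only [Function.comp, blockTuple, h, not_true_eq_false, if_false, hφeven]; omega
      · have := (hsign i).2 h
        simp only [Function.comp, blockTuple, h, not_false_eq_true, if_true, hφodd]; omega
    refine ⟨φ, ?_, ?_⟩
    · have hdecomp : ∀ v ∈ ((Icc 1 (r * 2) : Finset ℕ) : Set ℕ),
          ∃ i : Fin r, v = 2 * i.1 + 1 ∨ v = 2 * i.1 + 2 := by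
        intro v hv
        have := mem_Icc.1 (mem_coe.1 hv)
        exact ⟨⟨(v - 1) / 2, by omega⟩, by dsimp only; omega⟩
      have hne : ∀ i, min (x i) (y i) < max (x i) (y i) := fun i => by
        by_cases h : s i
        · have := (hsign i).1 h; omega
        · have := (hsign i).2 h; omega
      intro a ha b hb hab
      obtain ⟨i, hi⟩ := hdecomp a ha
      obtain ⟨k, hk⟩ := hdecomp b hb
      have h1 := hne i
      have h2 := hne k
      rcases (show i.1 ≤ k.1 by omega).lt_or_eq with hlt | heq
      · have := hsep i k hlt
        rcases hi with rfl | rfl <;> rcases hk with rfl | rfl <;>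
          simp only [hφodd, hφeven] <;> omega
      · obtain rfl := Fin.ext heq
        rcases hi with rfl | rfl <;> rcases hk with rfl | rfl <;>
          simp only [hφodd, hφeven] <;> omega
    · intro e he
      rw [hs, mem_insert, mem_singleton] at he
      rcases he with rfl | rfl
      · rwa [image_image, hφx]
      · rwa [image_image, hφy]

lemma exists_not_containsCopy {P : Finset (Finset ℕ)} (hP : IsPattern r P)
    (hs : P = {univ.image (blockTuple s), univ.image (blockTuple fun i => ¬ s i)}) :
    ∃ G, IsOrderedGraph r n G ∧ ¬ ContainsCopy G P ∧
      G.card = n.choose r - (n - r).choose r := by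
  refine ⟨(increasingTuples r n \ shiftableTuples s n).image fun x => univ.image x, ?_, ?_, ?_⟩
  · intro e he
    have := image_subset_image sdiff_subset he
    rw [image_univ_increasingTuples, mem_powersetCard] at this
    exact this.symm
  · rw [containsCopy_iff hP hs]
    rintro ⟨x, y, hx, hy, hxy⟩
    obtain ⟨x', hx', hxx'⟩ := mem_image.1 hx
    obtain ⟨y', hy', hyy'⟩ := mem_image.1 hy
    rw [mem_sdiff, mem_increasingTuples] at hx' hy'
    obtain rfl := hx'.1.2.eq_of_image_univ_eq hxy.strictMono hxx'
    refine hx'.2 (hxy.mem_shiftableTuples hx'.1.1 fun i => ?_)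
    have : y i ∈ univ.image y' := hyy' ▸ mem_image_of_mem y (mem_univ i)
    obtain ⟨k, -, hk⟩ := mem_image.1 this
    exact hk ▸ hy'.1.1 k
  · rw [card_image_of_injOn ((injOn_image_univ_increasingTuples r n).mono (by simp)),
      card_sdiff_of_subset shiftableTuples_subset_increasingTuples, card_increasingTuples,
      card_shiftableTuples]

lemma card_le_of_not_containsCopy {P G : Finset (Finset ℕ)} (hP : IsPattern r P)
    (hs : P = {univ.image (blockTuple s), univ.image (blockTuple fun i => ¬ s i)})
    (hG : IsOrderedGraph r n G) (hfree : ¬ ContainsCopy G P) :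
    G.card ≤ n.choose r - (n - r).choose r := by
  rw [containsCopy_iff hP hs] at hfree
  let F := (increasingTuples r n).filter fun x => univ.image x ∈ G
  have hGF : G.card ≤ F.card := by
    refine (card_le_card fun e he => ?_).trans (card_image_le (f := fun x => univ.image x))
    have : e ∈ (increasingTuples r n).image (fun x => univ.image x) := by
      rw [image_univ_increasingTuples, mem_powersetCard]
      exact (hG e he).symm
    obtain ⟨x, hx, rfl⟩ := mem_image.1 this
    exact mem_image.2 ⟨x, mem_filter.2 ⟨hx, he⟩, rfl⟩
  have hempty : (moveOrder s).foldr (improvable (signedValue s)) F = ∅ := by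
    refine eq_empty_of_forall_notMem fun x hx => hfree ?_
    obtain ⟨y, hy, hxy⟩ := exists_signedInterleaved_of_mem
      (fun x hx => (mem_increasingTuples.1 (mem_filter.1 hx).1).2) hx
    exact ⟨x, y, (mem_filter.1 (foldr_improvable_subset _ _ hx)).2, (mem_filter.1 hy).2, hxy⟩
  have h1 := card_add_card_foldr_improvable_le (signedValue_injective (s := s)) (moveOrder s)
    (filter_subset (fun x => univ.image x ∈ G) (increasingTuples r n))
  have h2 := card_le_card (shiftableTuples_subset_foldr_improvable (s := s) (n := n))
  rw [card_shiftableTuples] at h2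
  rw [card_increasingTuples] at h1
  change F.card + _ ≤ _ + (List.foldr _ F _).card at h1
  rw [hempty, card_empty] at h1
  omega

end SignedPairs

/-- **Theorem 1.9.** For `r, n ≥ 1` and any `r`-partite `r`-pattern `P`,
`ex_<(n, P) = C(n,r) - C((n-r)₊, r)`. -/
theorem extremal_number_partite_pattern (r n : ℕ) (hr : 1 ≤ r) (hn : 1 ≤ n)
    (P : Finset (Finset ℕ)) (hP : IsPattern r P) (hpart : IsPartite r 2 P) :
    exOrd r n P = n.choose r - (n - r).choose r := by
  obtain ⟨s, hs⟩ := exists_eq_blockTuple_pair hP hpart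
  refine IsGreatest.csSup_eq ⟨exists_not_containsCopy hP hs, ?_⟩
  rintro _ ⟨G, hG, hfree, rfl⟩
  exact card_le_of_not_containsCopy hP hs hG hfree
end

section
/- Let r, n, m ≥ 1 and let P be an r-pattern. If P is collectable, or if m ∈ {1,2}, then ex_<(n, P^(m)) ≥ C(n,r) − C((n−r(m−1))_+, r), where C(a,b) denotes the binomial coefficient. -/
/-- An `r`-pattern `P` is collectable if there exist `P`-cliques of every
size. -/
def IsCollectable (r : ℕ) (P : Finset (Finset ℕ)) : Prop :=
  ∀ m : ℕ, ∃ M, IsOrderedMatching r m M ∧ IsPatternClique P M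

/-- A strictly increasing map on an integer interval does not shrink distances. -/
lemma StrictMonoOn.add_sub_le_of_Icc {φ : ℕ → ℕ} {a b u v : ℕ}
    (hφ : StrictMonoOn φ (Set.Icc a b)) (hu : a ≤ u) (huv : u ≤ v) (hv : v ≤ b) :
    φ u + (v - u) ≤ φ v := by
  induction v, huv using Nat.le_induction with
  | base => simp
  | succ w hw ih =>
    have h₁ := ih (by omega)
    have h₂ : φ w < φ (w + 1) := hφ ⟨by omega, by omega⟩ ⟨by omega, hv⟩ (by omega)
    omega

open Finset in
/-- The number of elements of `{1,…,N}` outside `e` and below `v`. -/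
def gapsBelow (N : ℕ) (e : Finset ℕ) (v : ℕ) : ℕ :=
  #{x ∈ Icc 1 N \ e | x < v}

open Finset in
lemma gapsBelow_lt {N : ℕ} {e : Finset ℕ} {v : ℕ} (hv : 1 ≤ v) : gapsBelow N e v < v := by
  have h : gapsBelow N e v ≤ #(Ico 1 v) := card_le_card fun x hx => by
    simp only [mem_filter, mem_sdiff, mem_Icc, mem_Ico] at hx ⊢
    omega
  rw [Nat.card_Ico] at h
  omega

open Finset in
lemma gapsBelow_lt_add_sub {N : ℕ} {e : Finset ℕ} {u v : ℕ} (hu : u ∈ e) (huv : u < v) :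
    gapsBelow N e v < gapsBelow N e u + (v - u) := by
  have h : gapsBelow N e v ≤ #({x ∈ Icc 1 N \ e | x < u} ∪ Ioo u v) :=
    card_le_card fun x hx => by
      simp only [mem_filter, mem_sdiff, mem_Icc, mem_union, mem_Ioo] at hx ⊢
      have : x ≠ u := fun h => hx.1.2 (h ▸ hu)
      grind
  have h' := h.trans (card_union_le _ _)
  rw [Nat.card_Ioo] at h'
  unfold gapsBelow at h' ⊢
  omega

open Finset in
lemma sub_card_le_gapsBelow_add {N : ℕ} {e : Finset ℕ} (he : e ⊆ Icc 1 N) {v : ℕ} (hv : v ∈ e) :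
    N - #e ≤ gapsBelow N e v + (N - v) := by
  have h : #(Icc 1 N \ e) ≤ #({x ∈ Icc 1 N \ e | x < v} ∪ Ioc v N) :=
    card_le_card fun x hx => by
      simp only [mem_filter, mem_sdiff, mem_Icc, mem_union, mem_Ioc] at hx ⊢
      have : x ≠ v := fun h => hx.2 (h ▸ hv)
      grind
  have h' := h.trans (card_union_le _ _)
  rw [card_sdiff_of_subset he, Nat.card_Icc, Nat.card_Ioc] at h'
  unfold gapsBelow
  omega

open Finset in
/-- The sets arising as images of a fixed `e ⊆ {1,…,N}` under strictly increasing maps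
`{1,…,N} → {1,…,n}` are at most `C(n - (N - |e|), |e|)` many. -/
lemma card_le_choose_of_forall_exists_image {n N : ℕ} {e : Finset ℕ} (he : e ⊆ Icc 1 N)
    {B : Finset (Finset ℕ)}
    (hB : ∀ s ∈ B, ∃ φ : ℕ → ℕ, StrictMonoOn φ (Set.Icc 1 N) ∧
      (∀ x ∈ Icc 1 N, φ x ∈ Icc 1 n) ∧ e.image φ = s) :
    #B ≤ (n - (N - #e)).choose #e := by
  choose! φ hmono hmaps himage using hB
  let c := e.orderEmbOfFin rfl
  let ψ : Finset ℕ → Fin #e → ℕ := fun s i => φ s (c i) - gapsBelow N e (c i)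
  have hc : ∀ i, c i ∈ e := fun i => orderEmbOfFin_mem e rfl i
  have hcN : ∀ i, 1 ≤ c i ∧ c i ≤ N := fun i => mem_Icc.1 (he (hc i))
  have hlt : ∀ s ∈ B, ∀ i, gapsBelow N e (c i) < φ s (c i) := fun s hs i => by
    have h₁ := (hmono s hs).add_sub_le_of_Icc le_rfl (hcN i).1 (hcN i).2
    have h₂ := mem_Icc.1 (hmaps s hs 1 (by have := hcN i; simp; omega))
    have h₃ := gapsBelow_lt (N := N) (e := e) (hcN i).1
    omega
  have hψ : ∀ s ∈ B, StrictMono (ψ s) := fun s hs i j hij => by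
    have hcij : c i < c j := c.strictMono hij
    have h₁ := (hmono s hs).add_sub_le_of_Icc (hcN i).1 hcij.le (hcN j).2
    have h₂ := gapsBelow_lt_add_sub (N := N) (hc i) hcij
    have h₃ := hlt s hs i
    change φ s (c i) - _ < φ s (c j) - _
    omega
  have hcard : #(powersetCard #e (Icc 1 (n - (N - #e)))) = (n - (N - #e)).choose #e := by simp
  rw [← hcard]
  refine card_le_card_of_injOn (fun s => univ.image (ψ s)) (fun s hs => ?_) fun s hs t ht hst => ?_
  · rw [mem_coe] at hs
    simp only [mem_coe, mem_powersetCard, card_image_of_injective _ (hψ s hs).injective,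
      card_univ, Fintype.card_fin, and_true]
    refine image_subset_iff.2 fun i _ => mem_Icc.2 ?_
    have h₁ := (hmono s hs).add_sub_le_of_Icc (hcN i).1 (hcN i).2 le_rfl
    have h₂ := mem_Icc.1 (hmaps s hs N (by have := hcN i; simp; omega))
    have h₃ := hlt s hs i
    have h₄ := sub_card_le_gapsBelow_add he (hc i)
    change 1 ≤ φ s (c i) - _ ∧ φ s (c i) - _ ≤ _
    omega
  · rw [mem_coe] at hs ht
    have hrange : Set.range (ψ s) = Set.range (ψ t) := by
      simpa using congrArg (fun A : Finset ℕ => (A : Set ℕ)) hst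
    have heq : ψ s = ψ t := ((hψ s hs).range_inj (hψ t ht)).1 hrange
    rw [← himage s hs, ← himage t ht]
    refine image_congr fun x hx => ?_
    obtain ⟨i, rfl⟩ : x ∈ Set.range c := by
      rw [range_orderEmbOfFin]
      exact hx
    have h₁ := congrFun heq i
    change φ s (c i) - _ = φ t (c i) - _ at h₁
    have h₂ := hlt s hs i
    have h₃ := hlt t ht i
    omega

lemma IsOrderedGraph.card_le_exOrd {r n : ℕ} {G F : Finset (Finset ℕ)}
    (hG : IsOrderedGraph r n G) (hGF : ¬ ContainsCopy G F) : G.card ≤ exOrd r n F := by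
  refine le_csSup ⟨n.choose r, ?_⟩ ⟨G, hG, hGF, rfl⟩
  rintro _ ⟨H, hH, -, rfl⟩
  have h : H ⊆ Finset.powersetCard r (Finset.Icc 1 n) := fun e he =>
    Finset.mem_powersetCard.2 ⟨(hH e he).2, (hH e he).1⟩
  simpa using Finset.card_le_card h

open Finset in
/-- Any ordered graph on the vertex set `{1,…,N}` without isolated vertices and with an edge of
size `r` has extremal number at least `C(n,r) - C(n - (N - r), r)`. -/
lemma choose_sub_choose_le_exOrd {n N : ℕ} {F : Finset (Finset ℕ)}
    (hF : F.biUnion id = Icc 1 N) {e : Finset ℕ} (he : e ∈ F) :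
    n.choose #e - (n - (N - #e)).choose #e ≤ exOrd #e n F := by
  classical
  let B : Finset (Finset ℕ) := {s ∈ powersetCard #e (Icc 1 n) |
    ∃ φ : ℕ → ℕ, StrictMonoOn φ (Set.Icc 1 N) ∧
      (∀ x ∈ Icc 1 N, φ x ∈ Icc 1 n) ∧ e.image φ = s}
  have heN : e ⊆ Icc 1 N := hF ▸ subset_biUnion_of_mem id he
  have hB : #B ≤ (n - (N - #e)).choose #e :=
    card_le_choose_of_forall_exists_image heN fun s hs => (mem_filter.1 hs).2
  have hG : #(powersetCard #e (Icc 1 n) \ B) = n.choose #e - #B := by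
    rw [card_sdiff_of_subset (filter_subset _ _), card_powersetCard, Nat.card_Icc,
      Nat.add_sub_cancel]
  refine (Nat.sub_le_sub_left hB _).trans (hG ▸ IsOrderedGraph.card_le_exOrd ?_ ?_)
  · intro s hs
    exact (mem_powersetCard.1 (mem_sdiff.1 hs).1).symm
  · rintro ⟨φ, hφ, hmem⟩
    rw [hF, coe_Icc] at hφ
    have heG := mem_sdiff.1 (hmem e he)
    refine heG.2 (mem_filter.2 ⟨heG.1, φ, hφ, fun x hx => ?_, rfl⟩)
    rw [← hF] at hx
    obtain ⟨f, hf, hxf⟩ := mem_biUnion.1 hx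
    exact (mem_powersetCard.1 (mem_sdiff.1 (hmem f hf)).1).1 (mem_image_of_mem φ hxf)

/-- **Theorem 7.1.** Let `r, n, m ≥ 1` and let `P` be an `r`-pattern which is
collectable or for which `m ∈ {1, 2}`. Then
`ex_<(n, P^(m)) ≥ C(n,r) - C((n - r(m-1))₊, r)`, where `P^(m)` is the
(unique) `P`-clique with `m` edges, on the vertex set `{1,…,rm}`. -/
theorem extremal_number_clique_lower (r n m : ℕ) (hr : 1 ≤ r) (hn : 1 ≤ n) (hm : 1 ≤ m)
    (P : Finset (Finset ℕ)) (hP : IsPattern r P)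
    (hcase : IsCollectable r P ∨ m = 1 ∨ m = 2)
    (M : Finset (Finset ℕ)) (hM : IsOrderedMatching r m M) (hclique : IsPatternClique P M) :
    n.choose r - (n - r * (m - 1)).choose r ≤ exOrd r n M := by
  obtain ⟨hcard, hsize, -, hunion⟩ := hM
  obtain ⟨e, he⟩ := Finset.card_pos.1 (hcard ▸ hm : 0 < M.card)
  have h := choose_sub_choose_le_exOrd (n := n) hunion he
  rwa [hsize e he, ← Nat.mul_sub_one] at h
end

section
/- There is an absolute constant C > 0 such that for every r ≥ 1, every r-partite r-pattern P, every m ≥ 1, and every n sufficiently large in terms of r: ex_<(n, P^(m)) ≤ C·r²·(m−1)·C(n, r−1), where C(a,b) denotes the binomial coefficient. -/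
/-- Two arcs `p.1 < p.2` and `q.1 < q.2` cross, with `p` starting first. -/
def Crosses (p q : ℕ × ℕ) : Prop := p.1 < q.1 ∧ q.1 < p.2 ∧ p.2 < q.2

/-- The length of a longest strictly increasing chain of points of `B` strictly below `p`. -/
def chainRank (B : Finset (ℕ × ℕ)) (p : ℕ × ℕ) : ℕ :=
  (B.filter (fun q => q.1 < p.1 ∧ q.2 < p.2)).attach.sup (fun q => chainRank B q.1 + 1)
termination_by p.1
decreasing_by exact (Finset.mem_filter.1 q.2).2.1

theorem chainRank_lt {B : Finset (ℕ × ℕ)} {p q : ℕ × ℕ} (hq : q ∈ B) (h1 : q.1 < p.1)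
    (h2 : q.2 < p.2) : chainRank B q < chainRank B p := by
  rw [chainRank.eq_def B p]
  have := Finset.le_sup (s := (B.filter (fun q => q.1 < p.1 ∧ q.2 < p.2)).attach)
    (f := fun q => chainRank B q.1 + 1) (Finset.mem_attach _ ⟨q, by simp [hq, h1, h2]⟩)
  simpa using this

theorem exists_chainRank_eq {B : Finset (ℕ × ℕ)} {j : ℕ} (p : ℕ × ℕ) (hj : j < chainRank B p) :
    ∃ q ∈ B, q.1 < p.1 ∧ q.2 < p.2 ∧ chainRank B q = j := by
  induction hx : p.1 using Nat.strong_induction_on generalizing p with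
  | _ x ih =>
    have h := hj
    rw [chainRank.eq_def B p, Finset.lt_sup_iff] at h
    obtain ⟨⟨q, hq⟩, -, h⟩ := h
    simp only [Finset.mem_filter] at hq
    obtain ⟨hqB, h1, h2⟩ := hq
    rcases Nat.lt_succ_iff_lt_or_eq.1 h with h | h
    · obtain ⟨s, hs, h3, h4, h5⟩ := ih q.1 (by omega) q h rfl
      exact ⟨s, hs, by omega, by omega, h5⟩
    · exact ⟨q, hqB, by omega, h2, h.symm⟩

theorem exists_chain_length_eq {B : Finset (ℕ × ℕ)} (j : ℕ) (p : ℕ × ℕ) (hj : chainRank B p = j) :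
    ∃ L : List (ℕ × ℕ), L.length = j ∧ (∀ q ∈ L, q ∈ B) ∧
      (L ++ [p]).Pairwise (fun a b => a.1 < b.1 ∧ a.2 < b.2) := by
  induction j generalizing p with
  | zero => exact ⟨[], by simp⟩
  | succ j ih =>
    obtain ⟨q, hq, h1, h2, h3⟩ := exists_chainRank_eq (B := B) (j := j) p (by omega)
    obtain ⟨L, hL, hB, hP⟩ := ih q h3
    refine ⟨L ++ [q], by simp [hL], ?_, ?_⟩
    · intro s hs
      rcases List.mem_append.1 hs with hs | hs
      · exact hB s hs
      · rw [List.mem_singleton.1 hs]; exact hq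
    · rw [List.pairwise_append]
      refine ⟨hP, by simp, ?_⟩
      intro a ha b hb
      rw [List.mem_singleton.1 hb]
      rw [List.pairwise_append] at hP
      rcases List.mem_append.1 ha with ha | ha
      · have := hP.2.2 a ha q (by simp)
        omega
      · rw [List.mem_singleton.1 ha]; exact ⟨h1, h2⟩

/-- Replacing the left endpoints `≤ c` by their ranks does not create crossing families. -/
theorem exists_lift_of_pairwise_crosses {S B S' : Finset (ℕ × ℕ)} {c t : ℕ}
    (hB : B = S.filter (fun p => p.1 ≤ c ∧ c < p.2))
    (hS' : ∀ q ∈ S', (q ∈ S ∧ c < q.1) ∨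
      (q.1 ≤ c ∧ ∃ e ∈ B, q = (t + chainRank B e, e.2)))
    (L : List (ℕ × ℕ)) (hL : ∀ q ∈ L, q ∈ S') (hP : L.Pairwise Crosses) :
    ∃ L₂ : List (ℕ × ℕ), L₂.length = L.length ∧ (∀ w ∈ L₂, w ∈ S ∧ (w.1 ≤ c ∨ w ∈ L)) ∧
      L₂.Pairwise Crosses ∧ ∀ q T, L = q :: T → ∃ q' T', L₂ = q' :: T' ∧
        ((q' = q ∧ c < q.1) ∨
          (q.1 ≤ c ∧ q' ∈ B ∧ q.1 = t + chainRank B q' ∧ q.2 ≤ q'.2)) := by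
  have memB : ∀ e, e ∈ B ↔ e ∈ S ∧ e.1 ≤ c ∧ c < e.2 := by intro e; rw [hB]; simp
  induction L with
  | nil => exact ⟨[], by simp⟩
  | cons q L ih =>
    rw [List.pairwise_cons] at hP
    obtain ⟨L₂, hlen, hmem, hpw, hhead⟩ := ih (fun w hw => hL w (by simp [hw])) hP.2
    rcases hS' q (hL q (by simp)) with ⟨hqS, hqc⟩ | ⟨hqc, e, he, rfl⟩
    · have hw1 : ∀ w ∈ L₂, w ∈ L := by
        intro w hw
        rcases (hmem w hw).2 with h | h
        · exfalso
          cases L with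
          | nil => simp at hlen; simp [hlen] at hw
          | cons q1 T =>
            obtain ⟨q', T', rfl, hh⟩ := hhead q1 T rfl
            have hq1 := (hP.1 q1 (by simp)).1
            rcases hh with ⟨rfl, _⟩ | ⟨hh, _⟩
            · rw [List.pairwise_cons] at hpw
              rcases List.mem_cons.1 hw with rfl | hw
              · omega
              · have := (hpw.1 w hw).1
                omega
            · omega
        · exact h
      refine ⟨q :: L₂, by simp [hlen], ?_, ?_, ?_⟩
      · intro w hw
        rcases List.mem_cons.1 hw with rfl | hw
        · exact ⟨hqS, by simp⟩
        · exact ⟨(hmem w hw).1, by simp [hw1 w hw]⟩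
      · rw [List.pairwise_cons]
        exact ⟨fun w hw => hP.1 w (hw1 w hw), hpw⟩
      · intro q0 T h
        simp only [List.cons.injEq] at h
        obtain ⟨rfl, rfl⟩ := h
        exact ⟨q, L₂, rfl, Or.inl ⟨rfl, hqc⟩⟩
    · have key : ∃ q' ∈ B, chainRank B q' = chainRank B e ∧ e.2 ≤ q'.2 ∧
          ∀ w ∈ L₂, Crosses q' w := by
        cases L with
        | nil =>
          simp at hlen
          exact ⟨e, he, rfl, le_rfl, by simp [hlen]⟩
        | cons q1 T =>
          obtain ⟨q1', T', rfl, hh⟩ := hhead q1 T rfl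
          have hq1 := hP.1 q1 (by simp)
          have hew := (memB e).1 he
          rw [List.pairwise_cons] at hpw
          rcases hh with ⟨rfl, hc⟩ | ⟨hc, hq1B, hrk, hle⟩
          · refine ⟨e, he, rfl, le_rfl, ?_⟩
            intro w hw
            have hcw : c < w.1 := by
              rcases List.mem_cons.1 hw with rfl | hw
              · exact hc
              · have := (hpw.1 w hw).1
                omega
            have hwL : w ∈ q1' :: T := by
              rcases (hmem w hw).2 with h | h
              · omega
              · exact h
            have := hP.1 w hwL
            simp only [Crosses] at this ⊢
            omega
          · have hq1' := (memB q1').1 hq1B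
            have hlt : chainRank B e < chainRank B q1' := by
              have := hq1.1
              simp only at this
              omega
            have hex : ∃ q' ∈ B, chainRank B q' = chainRank B e ∧ e.2 ≤ q'.2 ∧
                q'.1 < q1'.1 ∧ q'.2 < q1'.2 := by
              by_cases hx : e.1 < q1'.1
              · have := hq1.2.2
                simp only at this
                exact ⟨e, he, rfl, le_rfl, hx, by omega⟩
              · obtain ⟨s, hs, h1, h2, h3⟩ := exists_chainRank_eq q1' hlt
                refine ⟨s, hs, h3, ?_, h1, h2⟩
                by_contra hcon
                have := chainRank_lt (p := e) hs (by omega) (by omega)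
                omega
            obtain ⟨q', hq'B, hr, hy, hx1, hx2⟩ := hex
            have hq' := (memB q').1 hq'B
            refine ⟨q', hq'B, hr, hy, ?_⟩
            intro w hw
            have hlow : q1'.1 ≤ w.1 ∧ q1'.2 ≤ w.2 := by
              rcases List.mem_cons.1 hw with rfl | hw
              · exact ⟨le_rfl, le_rfl⟩
              · have := hpw.1 w hw
                simp only [Crosses] at this
                omega
            refine ⟨by omega, ?_, by omega⟩
            rcases (hmem w hw).2 with h | h
            · omega
            · have := (hP.1 w h).2.1
              simp only at this
              omega
      obtain ⟨q', hq'B, hr, hy, hcr⟩ := key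
      have hq' := (memB q').1 hq'B
      refine ⟨q' :: L₂, by simp [hlen], ?_, ?_, ?_⟩
      · intro w hw
        rcases List.mem_cons.1 hw with rfl | hw
        · exact ⟨hq'.1, Or.inl hq'.2.1⟩
        · refine ⟨(hmem w hw).1, ?_⟩
          rcases (hmem w hw).2 with h | h
          · exact Or.inl h
          · exact Or.inr (by simp [h])
      · rw [List.pairwise_cons]
        exact ⟨hcr, hpw⟩
      · intro q0 T h
        simp only [List.cons.injEq] at h
        obtain ⟨rfl, rfl⟩ := h
        exact ⟨q', L₂, rfl, Or.inr ⟨hqc, hq'B, by simp [hr], hy⟩⟩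

/-- A graph on `n` linearly ordered vertices without `k + 1` pairwise crossing edges has at most
`6 * k * n` edges. -/
theorem card_le_of_pairwise_crosses (k : ℕ) (n a : ℕ) (S : Finset (ℕ × ℕ))
    (hS : ∀ p ∈ S, a < p.1 ∧ p.1 < p.2 ∧ p.2 ≤ a + n)
    (hk : ∀ L : List (ℕ × ℕ), (∀ q ∈ L, q ∈ S) → L.Pairwise Crosses → L.length ≤ k) :
    S.card ≤ 6 * k * n := by
  rcases Nat.eq_zero_or_pos k with rfl | hkpos
  · have : S = ∅ := by
      rw [Finset.eq_empty_iff_forall_notMem]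
      intro p hp
      have := hk [p] (by simpa using hp) (by simp)
      simp at this
    simp [this]
  induction n using Nat.strong_induction_on generalizing a S with
  | _ n ih =>
    by_cases hn : n < 2 * k
    · have hsub : S ⊆ Finset.Ioc a (a + n) ×ˢ Finset.Ioc a (a + n) := by
        intro p hp
        have := hS p hp
        simp only [Finset.mem_product, Finset.mem_Ioc]
        omega
      have := Finset.card_le_card hsub
      simp only [Finset.card_product, Nat.card_Ioc, Nat.add_sub_cancel_left] at this
      nlinarith
    · push Not at hn
      set c := a + 2 * k with hc
      set B := S.filter (fun p => p.1 ≤ c ∧ c < p.2) with hB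
      set t := a + k + 1 with ht
      set S₀ := S.filter (fun p => c < p.1) with hS₀
      set I := B.image (fun e => (t + chainRank B e, e.2)) with hI
      have memB : ∀ e, e ∈ B ↔ e ∈ S ∧ e.1 ≤ c ∧ c < e.2 := by intro e; simp [hB]
      have hrk : ∀ e ∈ B, chainRank B e < k := by
        intro e he
        obtain ⟨L, hL, hLB, hP⟩ := exists_chain_length_eq _ e (rfl : chainRank B e = _)
        have hin : ∀ q ∈ L ++ [e], q ∈ B := by
          intro q hq
          rcases List.mem_append.1 hq with hq | hq
          · exact hLB q hq
          · rw [List.mem_singleton.1 hq]; exact he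
        have := hk (L ++ [e]) (fun q hq => ((memB q).1 (hin q hq)).1) (by
          refine hP.imp_of_mem ?_
          intro p q hp hq h
          have h1 := (memB p).1 (hin p hp)
          have h2 := (memB q).1 (hin q hq)
          exact ⟨h.1, by omega, h.2⟩)
        simp [hL] at this
        omega
      have hIcard : (S₀ ∪ I).card ≤ 6 * k * (n - k) := by
        refine ih (n - k) (by omega) (a + k) (S₀ ∪ I) ?_ ?_
        · intro p hp
          rcases Finset.mem_union.1 hp with hp | hp
          · rw [hS₀, Finset.mem_filter] at hp
            have := hS p hp.1
            omega
          · rw [hI, Finset.mem_image] at hp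
            obtain ⟨e, he, rfl⟩ := hp
            have h1 := hrk e he
            have h2 := (memB e).1 he
            have h3 := hS e h2.1
            dsimp only
            omega
        · intro L hL hP
          obtain ⟨L₂, hlen, hmem, hpw, -⟩ := exists_lift_of_pairwise_crosses (S := S) (B := B)
            (S' := S₀ ∪ I) (c := c) (t := t) hB (by
              intro q hq
              rcases Finset.mem_union.1 hq with hq | hq
              · rw [hS₀, Finset.mem_filter] at hq
                exact Or.inl hq
              · rw [hI, Finset.mem_image] at hq
                obtain ⟨e, he, rfl⟩ := hq
                have h1 := hrk e he
                exact Or.inr ⟨by dsimp only; omega, e, he, rfl⟩) L hL hP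
          rw [← hlen]
          exact hk L₂ (fun w hw => (hmem w hw).1) hpw
      have hdisj : Disjoint S₀ I := by
        rw [Finset.disjoint_left]
        intro p hp hp'
        rw [hS₀, Finset.mem_filter] at hp
        rw [hI, Finset.mem_image] at hp'
        obtain ⟨e, he, rfl⟩ := hp'
        have h1 := hrk e he
        have := hp.2
        dsimp only at this
        omega
      rw [Finset.card_union_of_disjoint hdisj] at hIcard
      set Q : ℕ × ℕ → Prop := fun e => ∃ f ∈ B, f.1 < e.1 ∧ f.2 = e.2 ∧
        chainRank B f = chainRank B e with hQ
      classical
      have hBmin : (B.filter (fun e => ¬ Q e)).card ≤ I.card := by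
        refine Finset.card_le_card_of_injOn (fun e => (t + chainRank B e, e.2)) ?_ ?_
        · intro e he
          rw [Finset.mem_coe, Finset.mem_filter] at he
          exact Finset.mem_coe.2 (Finset.mem_image_of_mem _ he.1)
        · intro e he f hf hef
          rw [Finset.mem_coe, Finset.mem_filter] at he hf
          simp only [Prod.mk.injEq, Nat.add_left_cancel_iff] at hef
          rcases lt_trichotomy e.1 f.1 with h | h | h
          · exact absurd ⟨e, he.1, h, hef.2, hef.1⟩ hf.2
          · exact Prod.ext h hef.2
          · exact absurd ⟨f, hf.1, h, hef.2.symm, hef.1.symm⟩ he.2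
      have hBrest : (B.filter Q).card ≤ 2 * k * k := by
        have : (B.filter Q).card ≤ (Finset.Ioc a c ×ˢ Finset.range k).card := by
          refine Finset.card_le_card_of_injOn (fun e => (e.1, chainRank B e)) ?_ ?_
          · intro e he
            rw [Finset.mem_coe, Finset.mem_filter] at he
            have h1 := hrk e he.1
            have h2 := (memB e).1 he.1
            have h3 := hS e h2.1
            simp only [Finset.coe_product, Set.mem_prod, Finset.mem_coe, Finset.mem_Ioc,
              Finset.mem_range]
            omega
          · intro e he f hf hef
            rw [Finset.mem_coe, Finset.mem_filter] at he hf
            simp only [Prod.mk.injEq] at hef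
            obtain ⟨e', he', h1, h2, h3⟩ := he.2
            obtain ⟨f', hf', h4, h5, h6⟩ := hf.2
            rcases lt_trichotomy e.2 f.2 with h | h | h
            · have := chainRank_lt (p := f) he' (by omega) (by omega)
              omega
            · exact Prod.ext hef.1 h
            · have := chainRank_lt (p := e) hf' (by omega) (by omega)
              omega
        simpa [hc] using this
      have hlow : (S.filter (fun p => p.2 ≤ c)).card ≤ 2 * k * (2 * k) := by
        have hsub : S.filter (fun p => p.2 ≤ c) ⊆ Finset.Ioc a c ×ˢ Finset.Ioc a c := by
          intro p hp
          rw [Finset.mem_filter] at hp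
          have := hS p hp.1
          simp only [Finset.mem_product, Finset.mem_Ioc]
          omega
        have := Finset.card_le_card hsub
        simpa [hc] using this
      have hcover : S ⊆ S₀ ∪ (B.filter (fun e => ¬ Q e) ∪ B.filter Q) ∪
          S.filter (fun p => p.2 ≤ c) := by
        intro p hp
        by_cases h1 : c < p.1
        · simp [hS₀, hp, h1]
        by_cases h2 : p.2 ≤ c
        · simp [hp, h2]
        have : p ∈ B := (memB p).2 ⟨hp, by omega, by omega⟩
        by_cases h3 : Q p <;> simp [this, h3]
      have h1 := Finset.card_le_card hcover
      have h2 := Finset.card_union_le (S₀ ∪ (B.filter (fun e => ¬ Q e) ∪ B.filter Q))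
        (S.filter (fun p => p.2 ≤ c))
      have h3 := Finset.card_union_le S₀ (B.filter (fun e => ¬ Q e) ∪ B.filter Q)
      have h4 := Finset.card_union_le (B.filter (fun e => ¬ Q e)) (B.filter Q)
      obtain ⟨d, rfl⟩ : ∃ d, n = d + k := ⟨n - k, by omega⟩
      rw [Nat.add_sub_cancel] at hIcard
      nlinarith

/-- A graph on `n` linearly ordered vertices without `k + 1` pairwise nested edges has at most
`2 * k * n` edges. -/
theorem card_le_of_pairwise_nested (k : ℕ) (n : ℕ) (S : Finset (ℕ × ℕ))
    (hS : ∀ p ∈ S, 0 < p.1 ∧ p.1 < p.2 ∧ p.2 ≤ n)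
    (hk : ∀ L : List (ℕ × ℕ), (∀ q ∈ L, q ∈ S) →
      L.Pairwise (fun p q => p.1 < q.1 ∧ q.2 < p.2) → L.length ≤ k) :
    S.card ≤ 2 * k * n := by
  have h := Finset.card_le_mul_card_image_of_maps_to (s := S) (t := Finset.range (2 * n))
    (f := fun p => p.1 + p.2) (by
      intro p hp
      have := hS p hp
      simp only [Finset.mem_range]
      omega) k (by
      intro s _
      set T := S.filter (fun p => p.1 + p.2 = s) with hT
      have memT : ∀ p, p ∈ T ↔ p ∈ S ∧ p.1 + p.2 = s := by intro p; simp [hT]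
      set L := ((T.image Prod.fst).sort (· ≤ ·)).map (fun x => (x, s - x)) with hL
      have hmem : ∀ x ∈ (T.image Prod.fst).sort (· ≤ ·), (x, s - x) ∈ T := by
        intro x hx
        rw [Finset.mem_sort, Finset.mem_image] at hx
        obtain ⟨p, hp, rfl⟩ := hx
        have := ((memT p).1 hp).2
        have : (p.1, s - p.1) = p := Prod.ext rfl (by simp only; omega)
        rwa [this]
      have hlen : L.length = T.card := by
        rw [hL, List.length_map, Finset.length_sort, Finset.card_image_of_injOn]
        intro p hp q hq hpq
        have h1 := ((memT p).1 hp).2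
        have h2 := ((memT q).1 hq).2
        exact Prod.ext hpq (by omega)
      rw [← hlen]
      refine hk L ?_ ?_
      · intro q hq
        rw [hL, List.mem_map] at hq
        obtain ⟨x, hx, rfl⟩ := hq
        exact ((memT _).1 (hmem x hx)).1
      · rw [hL, List.pairwise_map]
        refine (Finset.sortedLT_sort (T.image Prod.fst)).pairwise.imp_of_mem ?_
        intro x y hx hy hxy
        have h1 := ((memT _).1 (hmem x hx)).2
        have h2 := ((memT _).1 (hmem y hy)).2
        simp only at h1 h2 ⊢
        omega)
  rw [Finset.card_range] at h
  nlinarith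

/-- `f` follows `e` in an ordered clique with sign vector `ε`: the `j`-th vertex moves in
direction `ε j`, and the `j`-th vertices of both edges precede the `j'`-th ones for `j < j'`. -/
def SignRel {r : ℕ} (ε e f : Fin r → ℤ) : Prop :=
  (∀ j, 0 < ε j * (f j - e j)) ∧ ∀ j j', j < j' → e j < f j' ∧ f j < e j'

/-- Edges that are determined by two of their coordinates, and whose other coordinates move
along, behave like the edges of an ordered graph. -/
theorem card_le_of_two_free_coordinates {r : ℕ} {ε : Fin r → ℤ} (hε : ∀ j, ε j = 1 ∨ ε j = -1)
    {k n : ℕ} {a : ℤ} {i p : Fin r} (hip : i < p) (F : Finset (Fin r → ℤ))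
    (hmono : ∀ e ∈ F, StrictMono e)
    (hsep : ∀ e ∈ F, ∀ f ∈ F, ∀ j j', j < j' → ¬ (j = i ∧ j' = p) → e j < f j')
    (hdir : ∀ e ∈ F, ∀ f ∈ F, 0 < ε i * (f i - e i) → ∀ j, j ≠ p → 0 < ε j * (f j - e j))
    (hinj : ∀ e ∈ F, ∀ f ∈ F, e i = f i → e p = f p → e = f)
    (hrange : ∀ e ∈ F, a < e i ∧ e p ≤ a + n)
    (hk : ∀ L : List (Fin r → ℤ), (∀ e ∈ L, e ∈ F) → L.Pairwise (SignRel ε) → L.length ≤ k) :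
    F.card ≤ 6 * k * n := by
  classical
  set π : (Fin r → ℤ) → ℕ × ℕ := fun e => ((e i - a).toNat, (e p - a).toNat) with hπ
  have hπF : ∀ e ∈ F, ((π e).1 : ℤ) = e i - a ∧ ((π e).2 : ℤ) = e p - a := by
    intro e he
    have h1 := hrange e he
    have h2 := hmono e he hip
    simp only [hπ]
    omega
  have hπinj : Set.InjOn π F := by
    intro e he f hf hef
    have h1 := hπF e he
    have h2 := hπF f hf
    rw [hef] at h1
    exact hinj e he f hf (by omega) (by omega)
  rw [← Finset.card_image_of_injOn hπinj]
  set S := F.image π with hS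
  have hex : ∀ q, ∃ e, q ∈ S → e ∈ F ∧ π e = q := by
    intro q
    by_cases hq : q ∈ S
    · obtain ⟨e, he, h⟩ := Finset.mem_image.1 hq
      exact ⟨e, fun _ => ⟨he, h⟩⟩
    · exact ⟨0, fun h => absurd h hq⟩
  choose g hg using hex
  have hrangeS : ∀ q ∈ S, 0 < q.1 ∧ q.1 < q.2 ∧ q.2 ≤ n := by
    intro q hq
    obtain ⟨e, he, rfl⟩ := Finset.mem_image.1 hq
    have h1 := hrange e he
    have h2 := hmono e he hip
    have h3 := hπF e he
    omega
  have hrel : ∀ e ∈ F, ∀ f ∈ F, 0 < ε i * (f i - e i) → 0 < ε p * (f p - e p) →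
      f i < e p → e i < f p → SignRel ε e f := by
    intro e he f hf h1 h2 h3 h4
    refine ⟨?_, ?_⟩
    · intro j
      by_cases hj : j = p
      · rw [hj]; exact h2
      · exact hdir e he f hf h1 j hj
    · intro j j' hjj
      by_cases h : j = i ∧ j' = p
      · obtain ⟨rfl, rfl⟩ := h
        exact ⟨h4, h3⟩
      · exact ⟨hsep e he f hf j j' hjj h, hsep f hf e he j j' hjj h⟩
  have hlists : ∀ R : ℕ × ℕ → ℕ × ℕ → Prop,
      (∀ q ∈ S, ∀ s ∈ S, R q s → q.1 < s.1 ∧ s.1 < q.2 ∧ q.1 < s.2 ∧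
        0 < ε i * ε p * ((s.2 : ℤ) - q.2)) →
      ∀ L : List (ℕ × ℕ), (∀ q ∈ L, q ∈ S) → L.Pairwise R → L.length ≤ k := by
    intro R hR L hL hP
    have hmemg : ∀ e ∈ L.map g, e ∈ F := by
      intro e he
      obtain ⟨q, hq, rfl⟩ := List.mem_map.1 he
      exact (hg q (hL q hq)).1
    have hP' : L.Pairwise (fun q s => q ∈ S ∧ s ∈ S ∧ R q s) :=
      hP.imp_of_mem (fun ha hb h => ⟨hL _ ha, hL _ hb, h⟩)
    rcases hε i with hi | hi
    · rw [← List.length_map (f := g)]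
      refine hk _ hmemg ?_
      rw [List.pairwise_map]
      refine hP'.imp ?_
      rintro q s ⟨hq, hs, h⟩
      obtain ⟨h1, h2, h3, h4⟩ := hR q hq s hs h
      obtain ⟨hqF, hqπ⟩ := hg q hq
      obtain ⟨hsF, hsπ⟩ := hg s hs
      have e1 := hπF _ hqF
      have e2 := hπF _ hsF
      rw [hqπ] at e1
      rw [hsπ] at e2
      refine hrel _ hqF _ hsF ?_ ?_ (by omega) (by omega)
      · rw [hi]; omega
      · rw [hi, e1.2, e2.2] at h4
        convert h4 using 1
        ring
    · rw [← List.length_map (f := g), ← List.length_reverse]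
      refine hk _ (fun e he => hmemg e (List.mem_reverse.1 he)) ?_
      rw [List.pairwise_reverse, List.pairwise_map]
      refine hP'.imp ?_
      rintro q s ⟨hq, hs, h⟩
      obtain ⟨h1, h2, h3, h4⟩ := hR q hq s hs h
      obtain ⟨hqF, hqπ⟩ := hg q hq
      obtain ⟨hsF, hsπ⟩ := hg s hs
      have e1 := hπF _ hqF
      have e2 := hπF _ hsF
      rw [hqπ] at e1
      rw [hsπ] at e2
      refine hrel _ hsF _ hqF ?_ ?_ (by omega) (by omega)
      · rw [hi]; omega
      · rw [hi, e1.2, e2.2] at h4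
        convert h4 using 1
        ring
  have hη : ε i * ε p = 1 ∨ ε i * ε p = -1 := by
    rcases hε i with h | h <;> rcases hε p with h' | h' <;> simp [h, h']
  rcases hη with hη | hη
  · refine card_le_of_pairwise_crosses k n 0 S (by simpa using hrangeS) ?_
    refine hlists Crosses ?_
    rintro q hq s hs ⟨h1, h2, h3⟩
    rw [hη]
    omega
  · refine (card_le_of_pairwise_nested k n S hrangeS ?_).trans (by nlinarith)
    refine hlists _ ?_
    rintro q hq s hs ⟨h1, h2⟩
    have := hrangeS s hs
    rw [hη]
    omega

theorem card_le_of_weighted_double_counting {α β : Type*} (H : Finset α) (Z : Finset β)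
    (R : α → β → Prop) [∀ e z, Decidable (R e z)] (σ : α → ℤ) (K : ℕ)
    (hσ : ∀ e ∈ H, 0 < σ e)
    (h1 : ∀ e ∈ H, σ e ≤ 16 * (Z.filter (fun z => R e z)).card)
    (h2 : ∀ z ∈ Z, ∀ e ∈ H, R e z → (∀ f ∈ H, R f z → 7 * σ e ≤ 8 * σ f) ∧
      ((H.filter (fun f => R f z)).card : ℤ) ≤ K * σ e) :
    7 * H.card ≤ 128 * K * Z.card := by
  have hH : (H.card : ℚ) ≤ ∑ e ∈ H, ∑ z ∈ Z with R e z, 16 / (σ e : ℚ) := by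
    rw [Finset.card_eq_sum_ones, Nat.cast_sum]
    refine Finset.sum_le_sum fun e he => ?_
    have hpos : (0 : ℚ) < σ e := by exact_mod_cast hσ e he
    have h := h1 e he
    have h' : (σ e : ℚ) ≤ 16 * (Z.filter (fun z => R e z)).card := by exact_mod_cast h
    rw [Finset.sum_const, nsmul_eq_mul, mul_div_assoc', le_div_iff₀ hpos]
    push_cast
    linarith
  have hswap : ∑ e ∈ H, ∑ z ∈ Z with R e z, 16 / (σ e : ℚ) =
      ∑ z ∈ Z, ∑ e ∈ H with R e z, 16 / (σ e : ℚ) := by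
    refine Finset.sum_comm' ?_
    intro e z
    simp only [Finset.mem_filter]
    tauto
  have hZ : ∑ z ∈ Z, ∑ e ∈ H with R e z, 16 / (σ e : ℚ) ≤ ∑ z ∈ Z, (128 * K / 7 : ℚ) := by
    refine Finset.sum_le_sum fun z hz => ?_
    rcases (H.filter (fun e => R e z)).eq_empty_or_nonempty with h | ⟨e, he⟩
    · rw [h, Finset.sum_empty]
      positivity
    · obtain ⟨heH, heR⟩ := Finset.mem_filter.1 he
      obtain ⟨h3, h4⟩ := h2 z hz e heH heR
      have hpos : (0 : ℚ) < σ e := by exact_mod_cast hσ e heH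
      have h4' : ((H.filter (fun f => R f z)).card : ℚ) ≤ K * σ e := by exact_mod_cast h4
      calc ∑ e ∈ H with R e z, 16 / (σ e : ℚ)
          ≤ ∑ f ∈ H with R f z, 128 / (7 * (σ e : ℚ)) := by
            refine Finset.sum_le_sum fun f hf => ?_
            obtain ⟨hfH, hfR⟩ := Finset.mem_filter.1 hf
            have hposf : (0 : ℚ) < σ f := by exact_mod_cast hσ f hfH
            have : (7 * σ e : ℚ) ≤ 8 * σ f := by exact_mod_cast h3 f hfH hfR
            rw [div_le_div_iff₀ hposf (by positivity)]
            linarith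
        _ ≤ 128 * K / 7 := by
            rw [Finset.sum_const, nsmul_eq_mul, mul_div_assoc',
              div_le_div_iff₀ (by positivity) (by norm_num)]
            nlinarith
  rw [Finset.sum_const, nsmul_eq_mul] at hZ
  have : (7 * H.card : ℚ) ≤ 128 * K * Z.card := by
    have := hH.trans (hswap.le.trans hZ)
    linarith
  exact_mod_cast this

/-- The smallest distance between two vertices of `e` other than the `p`-th one, capped at `c`. -/
noncomputable def minGap {r : ℕ} (c : ℤ) (p : Fin r) (e : Fin r → ℤ) : ℤ :=
  (insert c ((Finset.univ.filter (fun x : Fin r × Fin r => x.1 < x.2 ∧ x.1 ≠ p ∧ x.2 ≠ p)).image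
    (fun x => e x.2 - e x.1))).min' (Finset.insert_nonempty _ _)

theorem le_minGap_iff {r : ℕ} {c t : ℤ} {p : Fin r} {e : Fin r → ℤ} :
    t ≤ minGap c p e ↔ t ≤ c ∧ ∀ j j', j < j' → j ≠ p → j' ≠ p → t ≤ e j' - e j := by
  rw [minGap, Finset.le_min'_iff]
  simp only [Finset.mem_insert, Finset.mem_image, Finset.mem_filter, Finset.mem_univ, true_and,
    Prod.exists]
  constructor
  · intro h
    exact ⟨h c (Or.inl rfl), fun j j' h1 h2 h3 => h _ (Or.inr ⟨j, j', ⟨h1, h2, h3⟩, rfl⟩)⟩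
  · rintro ⟨h1, h2⟩ y (rfl | ⟨j, j', ⟨h3, h4, h5⟩, rfl⟩)
    · exact h1
    · exact h2 j j' h3 h4 h5

/-- Move every vertex of `e` by `t` in the direction opposite to the clique, and forget the `p`-th
vertex. -/
def shiftErase {r : ℕ} (ε : Fin r → ℤ) (p : Fin r) (e : Fin r → ℤ) (t : ℤ) : Fin r → ℤ :=
  Function.update (fun j => e j + t * ε j) p 0

theorem sub_eq_of_shiftErase_eq {r : ℕ} {ε : Fin r → ℤ} {p : Fin r} {e f : Fin r → ℤ} {s t : ℤ}
    (h : shiftErase ε p e s = shiftErase ε p f t) {j : Fin r} (hj : j ≠ p) :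
    f j - e j = (s - t) * ε j := by
  have := congrFun h j
  simp only [shiftErase, Function.update_of_ne hj] at this
  linarith

/-- Edges all of whose smallest gaps are between the `i`-th and the `p`-th vertex. -/
theorem card_le_of_smallest_gap {r : ℕ} {ε : Fin r → ℤ} (hε : ∀ j, ε j = 1 ∨ ε j = -1)
    {k : ℕ} {c : ℤ} {i p : Fin r} (hip : i < p) (H Z : Finset (Fin r → ℤ))
    (hmono : ∀ e ∈ H, StrictMono e)
    (hmin : ∀ e ∈ H, ∀ j j', j < j' → e p - e i ≤ e j' - e j)
    (hc : ∀ e ∈ H, e p - e i ≤ c)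
    (hZ : ∀ e ∈ H, ∀ t : ℤ, 0 ≤ t → 16 * t ≤ minGap c p e → shiftErase ε p e t ∈ Z)
    (hk : ∀ L : List (Fin r → ℤ), (∀ e ∈ L, e ∈ H) → L.Pairwise (SignRel ε) → L.length ≤ k) :
    7 * H.card ≤ 128 * (18 * k) * Z.card := by
  classical
  set R : (Fin r → ℤ) → (Fin r → ℤ) → Prop := fun e z =>
    ∃ t : ℤ, 0 ≤ t ∧ 16 * t ≤ minGap c p e ∧ shiftErase ε p e t = z with hR
  have hip' : i ≠ p := hip.ne
  have hgap : ∀ e ∈ H, e p - e i ≤ minGap c p e := fun e he =>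
    le_minGap_iff.2 ⟨hc e he, fun j j' h1 _ _ => hmin e he j j' h1⟩
  have hpos : ∀ e ∈ H, 0 < minGap c p e := by
    intro e he
    have h1 := hgap e he
    have h2 := hmono e he hip
    omega
  have hdiff : ∀ e : Fin r → ℤ, ∀ j j', j < j' → j ≠ p → j' ≠ p → minGap c p e ≤ e j' - e j :=
    fun e => (le_minGap_iff.1 le_rfl).2
  -- any two edges with the same image are close to each other
  have hclose : ∀ z, ∀ e, ∀ f, R e z → R f z → ∃ d : ℤ,
      (∀ j, j ≠ p → f j - e j = d * ε j) ∧ 7 * minGap c p e ≤ 8 * minGap c p f ∧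
      14 * d ≤ minGap c p e ∧ -(14 * d) ≤ minGap c p e := by
    rintro z e f ⟨s, hs0, hs, hez⟩ ⟨t, ht0, ht, hfz⟩
    have hd : ∀ j, j ≠ p → f j - e j = (s - t) * ε j := fun j hj =>
      sub_eq_of_shiftErase_eq (hez.trans hfz.symm) hj
    have hcomp : ∀ j, j ≠ p → |f j - e j| ≤ |s - t| := by
      intro j hj
      rw [hd j hj, abs_mul]
      rcases hε j with h | h <;> simp [h]
    have h1 : minGap c p e - 2 * |s - t| ≤ minGap c p f := by
      refine le_minGap_iff.2 ⟨?_, ?_⟩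
      · have := (le_minGap_iff.1 (le_refl (minGap c p e))).1
        have := abs_nonneg (s - t)
        omega
      · intro j j' hjj hj hj'
        have h1 := hdiff e j j' hjj hj hj'
        have h2 := abs_le.1 (hcomp j hj)
        have h3 := abs_le.1 (hcomp j' hj')
        omega
    have h2 : minGap c p f - 2 * |s - t| ≤ minGap c p e := by
      refine le_minGap_iff.2 ⟨?_, ?_⟩
      · have := (le_minGap_iff.1 (le_refl (minGap c p f))).1
        have := abs_nonneg (s - t)
        omega
      · intro j j' hjj hj hj'
        have h1 := hdiff f j j' hjj hj hj'
        have h2 := abs_le.1 (hcomp j hj)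
        have h3 := abs_le.1 (hcomp j' hj')
        omega
    refine ⟨s - t, hd, ?_⟩
    rcases abs_cases (s - t) with ⟨h, _⟩ | ⟨h, _⟩ <;> rw [h] at h1 h2 <;> omega
  refine card_le_of_weighted_double_counting H Z R (minGap c p) (18 * k) hpos ?_ ?_
  · intro e he
    have hsub : (Finset.range ((minGap c p e / 16).toNat + 1)).image
        (fun t : ℕ => shiftErase ε p e t) ⊆ Z.filter (fun z => R e z) := by
      intro z hz
      obtain ⟨t, ht, rfl⟩ := Finset.mem_image.1 hz
      rw [Finset.mem_range] at ht
      have := hpos e he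
      have ht' : 16 * (t : ℤ) ≤ minGap c p e := by omega
      exact Finset.mem_filter.2 ⟨hZ e he t (by omega) ht', t, by omega, ht', rfl⟩
    have hinj : Function.Injective (fun t : ℕ => shiftErase ε p e t) := by
      intro s t hst
      have := sub_eq_of_shiftErase_eq hst hip'
      rcases hε i with h | h <;> rw [h] at this <;> omega
    have h := Finset.card_le_card hsub
    rw [Finset.card_image_of_injective _ hinj, Finset.card_range] at h
    have := hpos e he
    omega
  · intro z hz e he hez
    refine ⟨fun f hf hfz => ?_, ?_⟩
    · obtain ⟨d, -, h, -⟩ := hclose z e f hez hfz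
      exact h
    · have hn : ((3 * minGap c p e).toNat : ℤ) = 3 * minGap c p e := by
        have := hpos e he
        omega
      have hoff : ∀ e ∈ H, ∀ f ∈ H, R e z → R f z → ∀ j j', j < j' → j ≠ p → j' ≠ p →
          e j < f j' := by
        intro e he f hf hez hfz j j' hjj hj hj'
        obtain ⟨d, h1, h2, h3, h4⟩ := hclose z e f hez hfz
        have h5 := hdiff e j j' hjj hj hj'
        have h6 := h1 j' hj'
        have h7 := hpos e he
        rcases hε j' with h | h <;> rw [h] at h6 <;> omega
      have key := card_le_of_two_free_coordinates hε (k := k) (n := (3 * minGap c p e).toNat)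
        (a := e i - minGap c p e) hip (H.filter (fun f => R f z)) ?_ ?_ ?_ ?_ ?_ ?_
      · have h' : ((H.filter (fun f => R f z)).card : ℤ) ≤
            6 * k * ((3 * minGap c p e).toNat : ℤ) := by exact_mod_cast key
        rw [hn] at h'
        push_cast
        linarith
      · intro e he
        exact hmono e (Finset.mem_filter.1 he).1
      · intro e heR f hfR j j' hjj hne
        obtain ⟨he, hez⟩ := Finset.mem_filter.1 heR
        obtain ⟨hf, hfz⟩ := Finset.mem_filter.1 hfR
        by_cases hj' : j' = p
        · subst hj'
          rcases lt_trichotomy j i with h | h | h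
          · exact (hoff e he f hf hez hfz j i h hjj.ne hip').trans (hmono f hf hip)
          · exact absurd ⟨h, rfl⟩ hne
          · have h1 := hmin e he i j h
            have h2 := hmono e he hjj
            omega
        · by_cases hj : j = p
          · subst hj
            obtain ⟨d, h1, h2, h3, h4⟩ := hclose z e f hez hfz
            have h5 := hdiff e i j' (hip.trans hjj) hip' hj'
            have h6 := hmin e he j j' hjj
            have h7 := h1 j' hj'
            have h8 := hpos e he
            rcases hε j' with h | h <;> rw [h] at h7 <;> omega
          · exact hoff e he f hf hez hfz j j' hjj hj hj'
      · intro e he f hf hi j hj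
        obtain ⟨he, hez⟩ := Finset.mem_filter.1 he
        obtain ⟨hf, hfz⟩ := Finset.mem_filter.1 hf
        obtain ⟨d, h1, -⟩ := hclose z e f hez hfz
        have h2 := h1 i hip'
        have h3 := h1 j hj
        rw [h2] at hi
        rw [h3]
        rcases hε i with h | h <;> rcases hε j with h' | h' <;> rw [h] at hi <;> rw [h'] <;> linarith
      · intro e he f hf hi hp
        obtain ⟨he, hez⟩ := Finset.mem_filter.1 he
        obtain ⟨hf, hfz⟩ := Finset.mem_filter.1 hf
        obtain ⟨d, h1, -⟩ := hclose z e f hez hfz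
        have h2 := h1 i hip'
        have hd0 : d = 0 := by rcases hε i with h | h <;> rw [h] at h2 <;> omega
        funext j
        by_cases hj : j = p
        · rw [hj, hp]
        · have h3 := h1 j hj
          rw [hd0] at h3
          omega
      · intro f hf
        obtain ⟨hf, hfz⟩ := Finset.mem_filter.1 hf
        obtain ⟨d, h1, h2, h3, h4⟩ := hclose z e f hez hfz
        obtain ⟨-, -, h5, -⟩ := hclose z f e hfz hez
        have h6 := h1 i hip'
        have h7 := hgap f hf
        have h8 := hpos e he
        rw [hn]
        rcases hε i with h | h <;> rw [h] at h6 <;> constructor <;> omega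
      · intro L hL hP
        exact hk L (fun e he => (Finset.mem_filter.1 (hL e he)).1) hP

theorem card_le_choose_of_strictMonoOn {r N : ℕ} {A : ℤ} {p : Fin r} (Z : Finset (Fin r → ℤ))
    (hp : ∀ z ∈ Z, z p = 0) (hmono : ∀ z ∈ Z, ∀ j j', j < j' → j ≠ p → j' ≠ p → z j < z j')
    (hrange : ∀ z ∈ Z, ∀ j, j ≠ p → A < z j ∧ z j ≤ A + N) :
    Z.card ≤ N.choose (r - 1) := by
  classical
  have hcard : (Finset.univ.erase p).card = r - 1 := by
    rw [Finset.card_erase_of_mem (Finset.mem_univ p), Finset.card_univ, Fintype.card_fin]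
  set o := (Finset.univ.erase p).orderEmbOfFin hcard with ho
  have hop : ∀ x, o x ≠ p := fun x =>
    (Finset.mem_erase.1 (Finset.orderEmbOfFin_mem (Finset.univ.erase p) hcard x)).1
  have hzo : ∀ z ∈ Z, StrictMono (z ∘ o) := fun z hz x y hxy =>
    hmono z hz _ _ (o.strictMono hxy) (hop x) (hop y)
  have hinjz : ∀ z ∈ Z, Set.InjOn z (Finset.univ.erase p : Finset (Fin r)) := by
    intro z hz j hj j' hj' h
    have hj := (Finset.mem_erase.1 hj).1
    have hj' := (Finset.mem_erase.1 hj').1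
    rcases lt_trichotomy j j' with h1 | h1 | h1
    · exact absurd h (hmono z hz _ _ h1 hj hj').ne
    · exact h1
    · exact absurd h (hmono z hz _ _ h1 hj' hj).ne'
  have hcardz : ∀ z ∈ Z, ((Finset.univ.erase p).image z).card = r - 1 := by
    intro z hz
    rw [Finset.card_image_of_injOn (hinjz z hz), hcard]
  have h := Finset.card_le_card_of_injOn (s := Z)
    (t := (Finset.Ioc A (A + N)).powersetCard (r - 1)) (fun z => (Finset.univ.erase p).image z)
    (by
      intro z hz
      rw [Finset.mem_coe, Finset.mem_powersetCard]
      refine ⟨?_, hcardz z hz⟩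
      intro x hx
      obtain ⟨j, hj, rfl⟩ := Finset.mem_image.1 hx
      exact Finset.mem_Ioc.2 (hrange z hz j (Finset.mem_erase.1 hj).1))
    (by
      intro z hz w hw hzw
      simp only at hzw
      have h1 := Finset.orderEmbOfFin_unique (hcardz z hz) (f := z ∘ o)
        (fun x => Finset.mem_image_of_mem z (Finset.orderEmbOfFin_mem _ hcard x)) (hzo z hz)
      have h2 := Finset.orderEmbOfFin_unique (hcardz z hz) (f := w ∘ o)
        (fun x => hzw ▸ Finset.mem_image_of_mem w (Finset.orderEmbOfFin_mem _ hcard x)) (hzo w hw)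
      funext j
      by_cases hj : j = p
      · rw [hj, hp z hz, hp w hw]
      · have hj' : j ∈ Set.range o := by
          rw [ho, Finset.range_orderEmbOfFin]
          simp [hj]
        obtain ⟨x, rfl⟩ := hj'
        exact congrFun (h1.trans h2.symm) x)
  rwa [Finset.card_powersetCard, Int.card_Ioc, add_sub_cancel_left, Int.toNat_natCast] at h

theorem mul_smallest_gap_le {r n : ℕ} {d : ℤ} {e : Fin r → ℤ} (hr : 2 ≤ r)
    (hd : ∀ j j', j < j' → d ≤ e j' - e j) (hrange : ∀ j, 1 ≤ e j ∧ e j ≤ n) :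
    ((r - 1 : ℕ) : ℤ) * d ≤ n := by
  have h : ∀ x : ℕ, ∀ hx : x < r, e ⟨0, by omega⟩ + x * d ≤ e ⟨x, hx⟩ := by
    intro x
    induction x with
    | zero => intro hx; simp
    | succ x ih =>
      intro hx
      have h1 := ih (by omega)
      have h2 := hd ⟨x, by omega⟩ ⟨x + 1, hx⟩ (by simp [Fin.lt_def])
      push_cast
      linarith
  have h1 := h (r - 1) (by omega)
  have h2 := hrange ⟨0, by omega⟩
  have h3 := hrange ⟨r - 1, by omega⟩
  linarith

theorem card_le_of_signRel_free {r n k : ℕ} (hr : 2 ≤ r) {ε : Fin r → ℤ}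
    (hε : ∀ j, ε j = 1 ∨ ε j = -1) (G : Finset (Fin r → ℤ))
    (hmono : ∀ e ∈ G, StrictMono e) (hrange : ∀ e ∈ G, ∀ j, 1 ≤ e j ∧ e j ≤ n)
    (hk : ∀ L : List (Fin r → ℤ), (∀ e ∈ L, e ∈ G) → L.Pairwise (SignRel ε) → L.length ≤ k) :
    7 * G.card ≤ r ^ 2 * (2304 * k * (n + 2 * (n / (r - 1) / 16)).choose (r - 1)) := by
  classical
  set E := n / (r - 1) / 16 with hE
  set c : ℤ := ((n / (r - 1) : ℕ) : ℤ) with hc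
  have hc0 : 0 ≤ c := Int.natCast_nonneg _
  have hpair : ∀ e : Fin r → ℤ, ∃ x : Fin r × Fin r, x.1 < x.2 ∧
      ∀ j j', j < j' → e x.2 - e x.1 ≤ e j' - e j := by
    intro e
    obtain ⟨x, hx, hmin⟩ := Finset.exists_min_image
      (Finset.univ.filter (fun x : Fin r × Fin r => x.1 < x.2)) (fun x => e x.2 - e x.1)
      ⟨(⟨0, by omega⟩, ⟨1, by omega⟩), by simp⟩
    refine ⟨x, (Finset.mem_filter.1 hx).2, fun j j' h => hmin (j, j') (by simp [h])⟩
  choose x hx hmin using hpair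
  have hle := Finset.card_le_mul_card_image_of_maps_to (s := G)
    (t := (Finset.univ : Finset (Fin r × Fin r))) (f := x) (fun _ _ => Finset.mem_univ _)
    (2304 * k * (n + 2 * E).choose (r - 1) / 7) (by
      rintro ⟨i, p⟩ -
      set H := G.filter (fun e => x e = (i, p)) with hH
      have memH : ∀ e, e ∈ H ↔ e ∈ G ∧ x e = (i, p) := by intro e; simp [hH]
      rcases H.eq_empty_or_nonempty with h | ⟨e0, he0⟩
      · rw [h]; simp
      have hip : i < p := by
        have := hx e0
        rw [((memH e0).1 he0).2] at this
        exact this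
      have hminH : ∀ e ∈ H, ∀ j j', j < j' → e p - e i ≤ e j' - e j := by
        intro e he
        have := hmin e
        rw [((memH e).1 he).2] at this
        exact this
      have hcH : ∀ e ∈ H, e p - e i ≤ c := by
        intro e he
        have h1 := mul_smallest_gap_le hr (hminH e he) (hrange e ((memH e).1 he).1)
        rw [hc, Int.natCast_ediv, Int.le_ediv_iff_mul_le (by omega)]
        linarith
      set Z := H.biUnion (fun e => (Finset.range ((minGap c p e / 16).toNat + 1)).image
        (fun t : ℕ => shiftErase ε p e t)) with hZ
      have memZ : ∀ z ∈ Z, ∃ e ∈ H, ∃ t : ℤ, 0 ≤ t ∧ 16 * t ≤ minGap c p e ∧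
          z = shiftErase ε p e t := by
        intro z hz
        rw [hZ, Finset.mem_biUnion] at hz
        obtain ⟨e, he, hz⟩ := hz
        obtain ⟨t, ht, rfl⟩ := Finset.mem_image.1 hz
        rw [Finset.mem_range] at ht
        refine ⟨e, he, t, by omega, ?_, rfl⟩
        have h1 : 0 ≤ minGap c p e := by
          refine le_minGap_iff.2 ⟨by omega, fun j j' h _ _ => ?_⟩
          have := hmono e ((memH e).1 he).1 h
          omega
        omega
      have hcard := card_le_of_smallest_gap hε hip H Z
        (fun e he => hmono e ((memH e).1 he).1) hminH hcH (by
          intro e he t ht0 ht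
          rw [hZ, Finset.mem_biUnion]
          refine ⟨e, he, Finset.mem_image.2 ⟨t.toNat, Finset.mem_range.2 (by omega), ?_⟩⟩
          rw [Int.toNat_of_nonneg ht0])
        (fun L hL => hk L (fun e he => ((memH e).1 (hL e he)).1))
      have hZc : Z.card ≤ (n + 2 * E).choose (r - 1) := by
        refine card_le_choose_of_strictMonoOn (A := -(E : ℤ)) (p := p) Z ?_ ?_ ?_
        · intro z hz
          obtain ⟨e, he, t, ht0, ht, rfl⟩ := memZ z hz
          simp [shiftErase]
        · intro z hz j j' hjj hj hj'
          obtain ⟨e, he, t, ht0, ht, rfl⟩ := memZ z hz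
          have h1 := (le_minGap_iff.1 (le_refl (minGap c p e))).2 j j' hjj hj hj'
          have h2 := hmono e ((memH e).1 he).1 hjj
          simp only [shiftErase, Function.update_of_ne hj, Function.update_of_ne hj']
          rcases hε j with h | h <;> rcases hε j' with h' | h' <;> rw [h, h'] <;> omega
        · intro z hz j hj
          obtain ⟨e, he, t, ht0, ht, rfl⟩ := memZ z hz
          have h1 := (le_minGap_iff.1 (le_refl (minGap c p e))).1
          have h2 := hrange e ((memH e).1 he).1 j
          simp only [shiftErase, Function.update_of_ne hj]
          push_cast
          rcases hε j with h | h <;> rw [h] <;> omega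
      rw [Nat.le_div_iff_mul_le (by norm_num)]
      calc H.card * 7 = 7 * H.card := by ring
        _ ≤ 128 * (18 * k) * Z.card := hcard
        _ ≤ 128 * (18 * k) * (n + 2 * E).choose (r - 1) := Nat.mul_le_mul_left _ hZc
        _ = _ := by ring)
  rw [Finset.card_univ, Fintype.card_prod, Fintype.card_fin] at hle
  have h7 := Nat.div_mul_le_self (2304 * k * (n + 2 * E).choose (r - 1)) 7
  calc 7 * G.card ≤ 7 * ((2304 * k * (n + 2 * E).choose (r - 1) / 7) * (r * r)) :=
        Nat.mul_le_mul_left _ hle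
    _ = r ^ 2 * ((2304 * k * (n + 2 * E).choose (r - 1) / 7) * 7) := by ring
    _ ≤ _ := Nat.mul_le_mul_left _ h7

theorem choose_add_le {r n : ℕ} (hr : 2 ≤ r) (hn : 2 * r ^ 2 ≤ n) :
    (n + 2 * (n / (r - 1) / 16)).choose (r - 1) ≤ 3 * n.choose (r - 1) := by
  obtain ⟨j, rfl⟩ : ∃ j, r = j + 1 := ⟨r - 1, by omega⟩
  simp only [Nat.add_sub_cancel]
  have hj : 1 ≤ j := by omega
  have hj0 : (0 : ℝ) < j := by exact_mod_cast hj
  have hE : (((n / j / 16 : ℕ)) : ℝ) ≤ n / j / 16 := by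
    refine Nat.cast_div_le.trans ?_
    gcongr
    · exact Nat.cast_div_le
    · norm_num
  have hn' : (2 * (j + 1) ^ 2 : ℝ) ≤ n := by exact_mod_cast hn
  have hnj : j ≤ n := by nlinarith
  have hcast : ((n + 1 - j : ℕ) : ℝ) = n + 1 - j := by
    rw [Nat.cast_sub (by omega)]
    push_cast
    ring
  have hbase : (n : ℝ) + 2 * ((n / j / 16 : ℕ) : ℝ) ≤ (1 / j + 1) * (n + 1 - j) := by
    have h2 : (1 / j + 1) * ((n : ℝ) + 1 - j) - (n + 2 * (n / j / 16)) =
        (7 * n / 8 + 1 - j ^ 2) / j := by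
      field_simp
      ring
    have h3 : 0 ≤ (7 * (n : ℝ) / 8 + 1 - j ^ 2) / j := by
      apply div_nonneg _ hj0.le
      nlinarith
    linarith
  have hexp : (1 / (j : ℝ) + 1) ^ j ≤ 3 := by
    have h1 : (1 / (j : ℝ) + 1) ^ j ≤ Real.exp (1 / j) ^ j :=
      pow_le_pow_left₀ (by positivity) (Real.add_one_le_exp _) _
    rw [← Real.exp_nat_mul, mul_one_div_cancel hj0.ne'] at h1
    have := Real.exp_one_lt_d9
    linarith
  have hlow := Nat.pow_le_choose (α := ℝ) j n
  have hup := Nat.choose_le_pow_div (α := ℝ) j (n + 2 * (n / j / 16))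
  have hf : (0 : ℝ) < (j.factorial : ℝ) := by exact_mod_cast j.factorial_pos
  have hmain : ((n + 2 * (n / j / 16) : ℕ) : ℝ) ^ j ≤ 3 * ((n + 1 - j : ℕ) : ℝ) ^ j := by
    calc ((n + 2 * (n / j / 16) : ℕ) : ℝ) ^ j ≤ ((1 / j + 1) * (n + 1 - j : ℝ)) ^ j := by
          push_cast
          gcongr
      _ = (1 / j + 1) ^ j * ((n + 1 - j : ℕ) : ℝ) ^ j := by rw [mul_pow, hcast]
      _ ≤ _ := by gcongr
  have : (((n + 2 * (n / j / 16)).choose j : ℕ) : ℝ) ≤ 3 * (n.choose j : ℝ) := by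
    calc (((n + 2 * (n / j / 16)).choose j : ℕ) : ℝ)
        ≤ ((n + 2 * (n / j / 16) : ℕ) : ℝ) ^ j / j.factorial := hup
      _ ≤ 3 * ((n + 1 - j : ℕ) : ℝ) ^ j / j.factorial := by gcongr
      _ = 3 * (((n + 1 - j : ℕ) : ℝ) ^ j / j.factorial) := by ring
      _ ≤ _ := by gcongr
  exact_mod_cast this

/-- A family of edges on `n` ordered vertices without a large clique of sign vector `ε`. -/
theorem card_le_mul_choose_of_signRel_free {r n k : ℕ} (hr : 1 ≤ r) (hn : 2 * r ^ 2 ≤ n)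
    {ε : Fin r → ℤ} (hε : ∀ j, ε j = 1 ∨ ε j = -1) (G : Finset (Fin r → ℤ))
    (hmono : ∀ e ∈ G, StrictMono e) (hrange : ∀ e ∈ G, ∀ j, 1 ≤ e j ∧ e j ≤ n)
    (hk : ∀ L : List (Fin r → ℤ), (∀ e ∈ L, e ∈ G) → L.Pairwise (SignRel ε) → L.length ≤ k) :
    G.card ≤ 1000 * r ^ 2 * k * n.choose (r - 1) := by
  classical
  rcases hr.eq_or_lt with rfl | hr
  · have hsq : ε 0 * ε 0 = 1 := by rcases hε 0 with h | h <;> rw [h] <;> rfl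
    have hback : ∀ e : Fin 1 → ℤ, (fun _ => ε 0 * (ε 0 * e 0)) = e := by
      intro e
      funext j
      rw [← mul_assoc, hsq, one_mul, Subsingleton.elim j 0]
    have h := hk (((G.image (fun e => ε 0 * e 0)).sort (· ≤ ·)).map (fun x _ => ε 0 * x)) (by
        intro e he
        obtain ⟨x, hx, rfl⟩ := List.mem_map.1 he
        rw [Finset.mem_sort, Finset.mem_image] at hx
        obtain ⟨f, hf, rfl⟩ := hx
        rwa [hback f]) (by
        rw [List.pairwise_map]
        refine (Finset.sortedLT_sort _).pairwise.imp ?_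
        intro x y hxy
        refine ⟨fun j => ?_, fun j j' h => absurd h (by omega)⟩
        rw [Subsingleton.elim j 0, ← mul_sub, ← mul_assoc, hsq]
        omega)
    rw [List.length_map, Finset.length_sort, Finset.card_image_of_injective] at h
    · simp only [Nat.sub_self, Nat.choose_zero_right]
      omega
    · intro e f hef
      simp only at hef
      rw [← hback e, ← hback f, hef]
  · have h1 := card_le_of_signRel_free hr hε G hmono hrange hk
    have h2 : r ^ 2 * (2304 * k * (n + 2 * (n / (r - 1) / 16)).choose (r - 1)) ≤
        r ^ 2 * (2304 * k * (3 * n.choose (r - 1))) := by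
      gcongr
      exact choose_add_le hr hn
    have h3 : r ^ 2 * (2304 * k * (3 * n.choose (r - 1))) =
        6912 * (r ^ 2 * k * n.choose (r - 1)) := by ring
    have h4 : 1000 * r ^ 2 * k * n.choose (r - 1) = 1000 * (r ^ 2 * k * n.choose (r - 1)) := by
      ring
    omega

/-- The vertices of an edge of size `r`, in increasing order. -/
noncomputable def vertex (r : ℕ) (e : Finset ℕ) : Fin r → ℕ :=
  if h : e.card = r then e.orderEmbOfFin h else 0

theorem vertex_strictMono {r : ℕ} {e : Finset ℕ} (h : e.card = r) : StrictMono (vertex r e) := by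
  rw [vertex, dif_pos h]
  exact (e.orderEmbOfFin h).strictMono

theorem image_vertex {r : ℕ} {e : Finset ℕ} (h : e.card = r) :
    Finset.univ.image (vertex r e) = e := by
  rw [vertex, dif_pos h, ← Finset.coe_inj, Finset.coe_image, Finset.coe_univ, Set.image_univ,
    Finset.range_orderEmbOfFin]

theorem vertex_mem {r : ℕ} {e : Finset ℕ} (h : e.card = r) (j : Fin r) : vertex r e j ∈ e := by
  have := Finset.mem_image_of_mem (vertex r e) (Finset.mem_univ j)
  rwa [image_vertex h] at this

theorem exists_vertex_eq {r : ℕ} {e : Finset ℕ} (h : e.card = r) {x : ℕ} (hx : x ∈ e) :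
    ∃ j, vertex r e j = x := by
  rw [← image_vertex h] at hx
  obtain ⟨j, -, hj⟩ := Finset.mem_image.1 hx
  exact ⟨j, hj⟩

theorem eq_vertex {r : ℕ} {e : Finset ℕ} (h : e.card = r) {v : Fin r → ℕ} (hv : StrictMono v)
    (hve : ∀ j, v j ∈ e) : v = vertex r e := by
  rw [vertex, dif_pos h]
  exact Finset.orderEmbOfFin_unique h hve hv

theorem vertex_image {r : ℕ} {e : Finset ℕ} (h : e.card = r) {φ : ℕ → ℕ}
    (hφ : StrictMonoOn φ e) (j : Fin r) : vertex r (e.image φ) j = φ (vertex r e j) := by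
  have hcard : (e.image φ).card = r := by rw [Finset.card_image_of_injOn hφ.injOn, h]
  refine (congrFun (eq_vertex hcard (v := fun j => φ (vertex r e j)) ?_ ?_) j).symm
  · intro x y hxy
    exact hφ (vertex_mem h x) (vertex_mem h y) (vertex_strictMono h hxy)
  · exact fun j => Finset.mem_image_of_mem _ (vertex_mem h j)

theorem SignRel.lt_and_lt {r : ℕ} {ε a b c d : Fin r → ℤ} (hab : SignRel ε a b)
    (hcd : SignRel ε c d) (j j' : Fin r) :
    (a j < b j' → c j < d j') ∧ (b j < a j' → d j < c j') := by
  rcases lt_trichotomy j j' with h | rfl | h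
  · exact ⟨fun _ => (hcd.2 j j' h).1, fun _ => (hcd.2 j j' h).2⟩
  · have h1 := hab.1 j
    have h2 := hcd.1 j
    constructor <;> intro h <;> by_contra! h' <;> nlinarith [abs_nonneg (ε j)]
  · have h1 := hab.2 j' j h
    exact ⟨fun h' => by omega, fun h' => by omega⟩

/-- The relation `SignRel` for edges. -/
def EdgeRel (r : ℕ) (ε : Fin r → ℤ) (e f : Finset ℕ) : Prop :=
  SignRel ε (fun j => (vertex r e j : ℤ)) (fun j => (vertex r f j : ℤ))

theorem EdgeRel.of_image {r : ℕ} {ε : Fin r → ℤ} (hε : ∀ j, ε j = 1 ∨ ε j = -1)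
    {e f : Finset ℕ} (he : e.card = r) (hf : f.card = r) {φ : ℕ → ℕ}
    (hφ : StrictMonoOn φ (↑(e ∪ f) : Set ℕ)) (h : EdgeRel r ε (e.image φ) (f.image φ)) :
    EdgeRel r ε e f := by
  have hφe : StrictMonoOn φ e := hφ.mono (by simp)
  have hφf : StrictMonoOn φ f := hφ.mono (by simp)
  have hlt : ∀ j j', vertex r (e.image φ) j < vertex r (f.image φ) j' ↔
      vertex r e j < vertex r f j' := by
    intro j j'
    rw [vertex_image he hφe, vertex_image hf hφf]
    exact hφ.lt_iff_lt (by simp [vertex_mem he j]) (by simp [vertex_mem hf j'])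
  have hlt' : ∀ j j', vertex r (f.image φ) j < vertex r (e.image φ) j' ↔
      vertex r f j < vertex r e j' := by
    intro j j'
    rw [vertex_image he hφe, vertex_image hf hφf]
    exact hφ.lt_iff_lt (by simp [vertex_mem hf j]) (by simp [vertex_mem he j'])
  obtain ⟨h1, h2⟩ := h
  refine ⟨fun j => ?_, fun j j' hjj => ?_⟩
  · have h3 := h1 j
    have h4 := hlt j j
    have h5 := hlt' j j
    simp only at h3 ⊢
    rcases hε j with h | h <;> rw [h] at h3 ⊢ <;> omega
  · have h3 := h2 j j' hjj
    have h4 := hlt j j'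
    have h5 := hlt' j j'
    simp only at h3 ⊢
    omega

/-- The two edges of an `r`-partite pattern are related by a sign vector. -/
theorem exists_edgeRel_of_isPartite {r : ℕ} {P : Finset (Finset ℕ)} (hP : IsPattern r P)
    (hpart : IsPartite r 2 P) : ∃ ε : Fin r → ℤ, (∀ j, ε j = 1 ∨ ε j = -1) ∧
      ∃ p q, P = {p, q} ∧ EdgeRel r ε p q := by
  obtain ⟨hcard, hr, hdisj, -⟩ := hP
  obtain ⟨p, q, hpq, rfl⟩ := Finset.card_eq_two.1 hcard
  have hvert : ∀ e ∈ ({p, q} : Finset (Finset ℕ)), ∀ j : Fin r,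
      2 * (j : ℕ) + 1 ≤ vertex r e j ∧ vertex r e j ≤ 2 * (j : ℕ) + 2 := by
    intro e he
    have hex : ∀ j : Fin r, ∃ x ∈ e, 2 * (j : ℕ) + 1 ≤ x ∧ x ≤ 2 * (j : ℕ) + 2 := by
      intro j
      have h := hpart e he (j + 1) (by omega) (by omega)
      obtain ⟨x, hx⟩ := Finset.card_eq_one.1 h
      replace hx := hx.ge (Finset.mem_singleton_self x)
      rw [Finset.mem_inter, Finset.mem_Icc] at hx
      exact ⟨x, hx.1, by omega, by omega⟩
    choose x hx h1 h2 using hex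
    have hxm : StrictMono x := by
      intro j j' hjj
      have := h2 j
      have := h1 j'
      have : (j : ℕ) < j' := hjj
      omega
    rw [← eq_vertex (hr e he) hxm hx]
    exact fun j => ⟨h1 j, h2 j⟩
  have hp : p ∈ ({p, q} : Finset (Finset ℕ)) := by simp
  have hq : q ∈ ({p, q} : Finset (Finset ℕ)) := by simp
  refine ⟨fun j => if vertex r p j < vertex r q j then 1 else -1, fun j => ?_, p, q, rfl, ?_, ?_⟩
  · by_cases h : vertex r p j < vertex r q j <;> simp [h]
  · intro j
    have hne : vertex r p j ≠ vertex r q j := fun h =>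
      Finset.disjoint_left.1 (hdisj p hp q hq hpq) (vertex_mem (hr p hp) j)
        (h ▸ vertex_mem (hr q hq) j)
    simp only
    split_ifs <;> omega
  · intro j j' hjj
    have h1 := hvert p hp j
    have h2 := hvert p hp j'
    have h3 := hvert q hq j
    have h4 := hvert q hq j'
    have : (j : ℕ) < j' := hjj
    simp only
    omega

/-- A sufficiently long sequence of related edges of `G` is a copy of the clique `M`. -/
theorem containsCopy_of_edgeRel {r m : ℕ} (hr : 1 ≤ r) {ε : Fin r → ℤ} {M G : Finset (Finset ℕ)}
    (hM : IsOrderedMatching r m M)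
    (htot : ∀ e ∈ M, ∀ f ∈ M, e ≠ f → EdgeRel r ε e f ∨ EdgeRel r ε f e)
    (hG : ∀ e ∈ G, e.card = r) (u : ℕ → Finset ℕ) (hu : ∀ a < m, u a ∈ G)
    (hrel : ∀ a b, a < b → b < m → EdgeRel r ε (u a) (u b)) : ContainsCopy G M := by
  classical
  obtain ⟨hcard, hMr, hdisj, -⟩ := hM
  set key : Finset ℕ → ℤ := fun e => ε ⟨0, hr⟩ * vertex r e ⟨0, hr⟩ with hkey
  set rk : Finset ℕ → ℕ := fun e => (M.filter (fun g => key g < key e)).card with hrk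
  have hrk_lt : ∀ e ∈ M, rk e < m := by
    intro e he
    rw [← hcard]
    refine Finset.card_lt_card ⟨Finset.filter_subset _ _, fun h => ?_⟩
    exact lt_irrefl _ (Finset.mem_filter.1 (h he)).2
  have hrk_mono : ∀ e ∈ M, ∀ f ∈ M, EdgeRel r ε e f → rk e < rk f := by
    intro e he f hf hef
    have hlt : key e < key f := by
      have := hef.1 ⟨0, hr⟩
      simp only [mul_sub] at this
      simp only [hkey]
      omega
    refine Finset.card_lt_card ⟨fun g hg => ?_, fun h => ?_⟩
    · rw [Finset.mem_filter] at hg ⊢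
      exact ⟨hg.1, hg.2.trans hlt⟩
    · exact lt_irrefl _ (Finset.mem_filter.1 (h (Finset.mem_filter.2 ⟨he, hlt⟩))).2
  have hψ : ∀ x, ∃ y, ∀ e ∈ M, ∀ j, vertex r e j = x → y = vertex r (u (rk e)) j := by
    intro x
    by_cases h : ∃ e ∈ M, ∃ j, vertex r e j = x
    · obtain ⟨e, he, j, hj⟩ := h
      refine ⟨vertex r (u (rk e)) j, fun f hf j' hj' => ?_⟩
      have hef : e = f := by
        by_contra hne
        exact Finset.disjoint_left.1 (hdisj e he f hf hne) (vertex_mem (hMr e he) j)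
          (hj.trans hj'.symm ▸ vertex_mem (hMr f hf) j')
      subst hef
      rw [(vertex_strictMono (hMr e he)).injective (hj.trans hj'.symm)]
    · exact ⟨0, fun e he j hj => absurd ⟨e, he, j, hj⟩ h⟩
  choose ψ hψ using hψ
  have hψv : ∀ e ∈ M, ∀ j, ψ (vertex r e j) = vertex r (u (rk e)) j := fun e he j =>
    hψ _ e he j rfl
  refine ⟨ψ, ?_, ?_⟩
  · intro x hx y hy hxy
    simp only [Finset.coe_biUnion, Set.mem_iUnion, Finset.mem_coe, id] at hx hy
    obtain ⟨e, he, hx⟩ := hx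
    obtain ⟨f, hf, hy⟩ := hy
    obtain ⟨j, rfl⟩ := exists_vertex_eq (hMr e he) hx
    obtain ⟨j', rfl⟩ := exists_vertex_eq (hMr f hf) hy
    rw [hψv e he, hψv f hf]
    by_cases hef : e = f
    · subst hef
      exact vertex_strictMono (hG _ (hu _ (hrk_lt e he)))
        ((vertex_strictMono (hMr e he)).lt_iff_lt.1 hxy)
    · rcases htot e he f hf hef with h | h
      · have h' := hrel _ _ (hrk_mono e he f hf h) (hrk_lt f hf)
        have := (SignRel.lt_and_lt h h' j j').1 (by exact_mod_cast hxy)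
        exact_mod_cast this
      · have h' := hrel _ _ (hrk_mono f hf e he h) (hrk_lt e he)
        have := (SignRel.lt_and_lt h h' j j').2 (by exact_mod_cast hxy)
        exact_mod_cast this
  · intro e he
    have h : e.image ψ = u (rk e) := by
      conv_lhs => rw [← image_vertex (hMr e he)]
      conv_rhs => rw [← image_vertex (hG _ (hu _ (hrk_lt e he)))]
      rw [Finset.image_image]
      exact Finset.image_congr fun j _ => hψv e he j
    rw [h]
    exact hu _ (hrk_lt e he)

theorem card_le_of_not_containsCopy_s9 {r n m : ℕ} (hr : 1 ≤ r) (hn : 2 * r ^ 2 ≤ n) (hm : 1 ≤ m)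
    {P M G : Finset (Finset ℕ)} (hP : IsPattern r P) (hpart : IsPartite r 2 P)
    (hM : IsOrderedMatching r m M) (hclique : IsPatternClique P M) (hG : IsOrderedGraph r n G)
    (hfree : ¬ ContainsCopy G M) :
    G.card ≤ 1000 * r ^ 2 * (m - 1) * n.choose (r - 1) := by
  classical
  obtain ⟨ε, hε, p, q, hPpq, hpq⟩ := exists_edgeRel_of_isPartite hP hpart
  have htot : ∀ e ∈ M, ∀ f ∈ M, e ≠ f → EdgeRel r ε e f ∨ EdgeRel r ε f e := by
    intro e he f hf hef
    have her := hM.2.1 e he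
    have hfr := hM.2.1 f hf
    obtain ⟨φ, hφ, himg⟩ := hclique e he f hf hef
    rw [hPpq] at himg
    have himg' : e.image φ = p ∧ f.image φ = q ∨ e.image φ = q ∧ f.image φ = p := by
      have h := congrArg (fun s : Finset (Finset ℕ) => (s : Set (Finset ℕ))) himg
      simp only [Finset.coe_insert, Finset.coe_singleton] at h
      exact Set.pair_eq_pair_iff.1 h
    rcases himg' with ⟨h1, h2⟩ | ⟨h1, h2⟩
    · exact Or.inl (EdgeRel.of_image hε her hfr hφ (by rwa [h1, h2]))
    · exact Or.inr (EdgeRel.of_image hε hfr her (by rwa [Finset.union_comm]) (by rwa [h1, h2]))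
  set ι : Finset ℕ → Fin r → ℤ := fun e j => (vertex r e j : ℤ) with hι
  have hinj : Set.InjOn ι G := by
    intro e he f hf hef
    rw [← image_vertex (hG e he).1, ← image_vertex (hG f hf).1]
    congr 1
    funext j
    exact Nat.cast_injective (congrFun hef j)
  rw [← Finset.card_image_of_injOn hinj]
  refine card_le_mul_choose_of_signRel_free hr hn hε (G.image ι) ?_ ?_ ?_
  · intro x hx
    obtain ⟨e, he, rfl⟩ := Finset.mem_image.1 hx
    intro j j' hjj
    exact Nat.cast_lt.2 (vertex_strictMono (hG e he).1 hjj)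
  · intro x hx j
    obtain ⟨e, he, rfl⟩ := Finset.mem_image.1 hx
    have := Finset.mem_Icc.1 ((hG e he).2 (vertex_mem (hG e he).1 j))
    simp only [hι]
    omega
  · intro L hL hrel
    by_contra! hlen
    refine hfree ?_
    have hex : ∀ a, ∃ e, ∀ ha : a < L.length, e ∈ G ∧ ι e = L[a] := by
      intro a
      by_cases ha : a < L.length
      · obtain ⟨e, he, h⟩ := Finset.mem_image.1 (hL _ (List.getElem_mem ha))
        exact ⟨e, fun _ => ⟨he, h⟩⟩
      · exact ⟨∅, fun h => absurd h ha⟩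
    choose u hu using hex
    refine containsCopy_of_edgeRel hr hM htot (fun e he => (hG e he).1) u
      (fun a ha => (hu a (by omega)).1) ?_
    intro a b hab hb
    have h := List.pairwise_iff_getElem.1 hrel a b (by omega) (by omega) hab
    rw [← (hu a (by omega)).2, ← (hu b (by omega)).2] at h
    exact h

/-- **Theorem 1.10(2).** There is an absolute constant `C > 0` such that for
every `r ≥ 1`, every `r`-partite `r`-pattern `P` and every `m ≥ 1`, for all
`n` sufficiently large in terms of `r`,
`ex_<(n, P^(m)) ≤ C · r² · (m-1) · C(n, r-1)`, where `P^(m)` is the (unique)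
`P`-clique with `m` edges, on the vertex set `{1,…,rm}`. -/
theorem extremal_number_clique_upper :
    ∃ C : ℝ, 0 < C ∧ ∀ r : ℕ, 1 ≤ r → ∃ N : ℕ, ∀ n : ℕ, N ≤ n →
      ∀ m : ℕ, 1 ≤ m → ∀ P : Finset (Finset ℕ), IsPattern r P → IsPartite r 2 P →
      ∀ M : Finset (Finset ℕ), IsOrderedMatching r m M → IsPatternClique P M →
        (exOrd r n M : ℝ) ≤ C * (r : ℝ) ^ 2 * ((m - 1 : ℕ) : ℝ) * (n.choose (r - 1) : ℝ) := by
  refine ⟨1000, by norm_num, fun r hr => ⟨2 * r ^ 2, ?_⟩⟩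
  intro n hn m hm P hP hpart M hM hclique
  have h : exOrd r n M ≤ 1000 * r ^ 2 * (m - 1) * n.choose (r - 1) := by
    refine csSup_le' ?_
    rintro _ ⟨G, hG, hfree, rfl⟩
    exact card_le_of_not_containsCopy_s9 hr hn hm hP hpart hM hclique hG hfree
  exact_mod_cast h
end

section
/- Let r, n, m ≥ 1, and let P be the alternating r-pattern: the r-pattern on {1,…,2r} whose two edges are A = {j ∈ {1,…,2r} : j ≡ 0 or 1 (mod 4)} and B = {j ∈ {1,…,2r} : j ≡ 2 or 3 (mod 4)} (block representation |AB|BA|AB|BA|⋯|). Then ex_<(n, P^(m)) = C(n,r) − C((n−r(m−1))_+, r), where C(a,b) denotes the binomial coefficient. -/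
/-- The alternating `r`-pattern `|AB|BA|AB|BA|⋯|` on `{1,…,2r}`: its two edges
are `A = {j : j ≡ 0 or 1 (mod 4)}` and `B = {j : j ≡ 2 or 3 (mod 4)}`. -/
def altPattern (r : ℕ) : Finset (Finset ℕ) :=
  { (Finset.Icc 1 (2 * r)).filter (fun j => j % 4 = 0 ∨ j % 4 = 1),
    (Finset.Icc 1 (2 * r)).filter (fun j => j % 4 = 2 ∨ j % 4 = 3) }

/-- The `i`-th smallest element (counting from `0`) of a finite set of naturals,
with value `0` when `i` is out of range. -/
noncomputable def sortedSeq (e : Finset ℕ) (i : ℕ) : ℕ :=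
  if h : i < e.card then e.orderEmbOfFin rfl ⟨i, h⟩ else 0

/-- `E 0, …, E (m-1)` are the increasing enumerations of the edges of an alternating
clique of `r`-sets, listed by increasing first vertex. -/
def IsAltGrid (r m : ℕ) (E : ℕ → ℕ → ℕ) : Prop :=
  (∀ k < m, ∀ l < m, ∀ i j, i < j → j < r → E k i < E l j) ∧
    ∀ k l, k < l → l < m → ∀ i < r, (Even i → E k i < E l i) ∧ (¬ Even i → E l i < E k i)

/-- An `r`-subset `e` of `{1,…,n}` such that `e` can be translated `d` times by
`(1, -1, 1, -1, …)` while remaining an `r`-subset of `{1,…,n}`. -/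
def IsShiftable (r n d : ℕ) (e : Finset ℕ) : Prop :=
  (∀ i, Even i → i + 1 < r → sortedSeq e i + 2 * d < sortedSeq e (i + 1)) ∧
    (Odd r → sortedSeq e (r - 1) + d ≤ n)

/-- The translate of the sequence `a` by `k` times `(1, -1, 1, -1, …)`. -/
def altShift (a : ℕ → ℕ) (k i : ℕ) : ℕ := if Even i then a i + k else a i - k

/-- An invariant of a sequence under `altShift`. -/
noncomputable def lineInvariant (r : ℕ) (e : Finset ℕ) (i : Fin r) : ℕ :=
  if Even (i : ℕ) then sortedSeq e i - sortedSeq e 0 else sortedSeq e i + sortedSeq e 0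

theorem sortedSeq_mem {e : Finset ℕ} {i : ℕ} (h : i < e.card) : sortedSeq e i ∈ e := by
  simp only [sortedSeq, h, dif_pos]
  exact Finset.orderEmbOfFin_mem e rfl _

theorem sortedSeq_lt {e : Finset ℕ} {i j : ℕ} (hij : i < j) (h : j < e.card) :
    sortedSeq e i < sortedSeq e j := by
  simp only [sortedSeq, h, hij.trans h, dif_pos]
  exact (e.orderEmbOfFin rfl).strictMono hij

theorem sortedSeq_le {e : Finset ℕ} {i j : ℕ} (hij : i ≤ j) (h : j < e.card) :
    sortedSeq e i ≤ sortedSeq e j := by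
  rcases hij.eq_or_lt with rfl | hij
  · rfl
  · exact (sortedSeq_lt hij h).le

theorem injOn_range_of_lt {r : ℕ} {a : ℕ → ℕ} (ha : ∀ i j, i < j → j < r → a i < a j) :
    Set.InjOn a (Finset.range r) := by
  intro i hi j hj hij
  have hi' := Finset.mem_range.1 hi
  have hj' := Finset.mem_range.1 hj
  rcases lt_trichotomy i j with h | h | h
  · exact absurd hij (ha i j h hj').ne
  · exact h
  · exact absurd hij (ha j i h hi').ne'

theorem card_image_range_of_lt {r : ℕ} {a : ℕ → ℕ} (ha : ∀ i j, i < j → j < r → a i < a j) :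
    ((Finset.range r).image a).card = r := by
  rw [Finset.card_image_of_injOn (injOn_range_of_lt ha), Finset.card_range]

theorem sortedSeq_image_range {r : ℕ} {a : ℕ → ℕ} (ha : ∀ i j, i < j → j < r → a i < a j)
    {i : ℕ} (hi : i < r) : sortedSeq ((Finset.range r).image a) i = a i := by
  have hc := card_image_range_of_lt ha
  have hu := Finset.orderEmbOfFin_unique (s := (Finset.range r).image a) rfl
    (f := fun x => a x)
    (fun x => Finset.mem_image_of_mem a (Finset.mem_range.2 (x.2.trans_eq hc)))
    (fun x y hxy => ha x y hxy (y.2.trans_eq hc))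
  have hi' : i < ((Finset.range r).image a).card := hi.trans_eq hc.symm
  simp only [sortedSeq, hi', dif_pos]
  exact (congrFun hu ⟨i, hi'⟩).symm

theorem image_sortedSeq {e : Finset ℕ} {r : ℕ} (h : e.card = r) :
    (Finset.range r).image (sortedSeq e) = e := by
  apply Finset.eq_of_subset_of_card_le
  · intro x hx
    obtain ⟨i, hi, rfl⟩ := Finset.mem_image.1 hx
    exact sortedSeq_mem (h ▸ Finset.mem_range.1 hi)
  · rw [card_image_range_of_lt fun i j hij hj => sortedSeq_lt hij (h ▸ hj), h]

theorem sortedSeq_injOn {e f : Finset ℕ} {r : ℕ} (he : e.card = r) (hf : f.card = r)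
    (h : ∀ i < r, sortedSeq e i = sortedSeq f i) : e = f := by
  rw [← image_sortedSeq he, ← image_sortedSeq hf]
  exact Finset.image_congr fun i hi => h i (Finset.mem_range.1 hi)

theorem sortedSeq_image {e : Finset ℕ} {r : ℕ} (he : e.card = r) {φ : ℕ → ℕ}
    (hφ : StrictMonoOn φ e) {i : ℕ} (hi : i < r) :
    sortedSeq (e.image φ) i = φ (sortedSeq e i) := by
  have : e.image φ = (Finset.range r).image (φ ∘ sortedSeq e) := by
    rw [← Finset.image_image, image_sortedSeq he]
  rw [this]
  refine sortedSeq_image_range (fun i j hij hj => ?_) hi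
  exact hφ (sortedSeq_mem (by omega)) (sortedSeq_mem (by omega)) (sortedSeq_lt hij (by omega))

theorem altPattern_fst_eq (r : ℕ) :
    (Finset.Icc 1 (2 * r)).filter (fun j => j % 4 = 0 ∨ j % 4 = 1) =
      (Finset.range r).image (fun i => if Even i then 2 * i + 1 else 2 * i + 2) := by
  ext x
  simp only [Finset.mem_filter, Finset.mem_Icc, Finset.mem_image, Finset.mem_range]
  constructor
  · rintro ⟨h, h'⟩
    refine ⟨(x - 1) / 2, by omega, ?_⟩
    split_ifs with hp <;> rw [Nat.even_iff] at hp <;> omega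
  · rintro ⟨i, hi, h⟩
    split_ifs at h with hp <;> rw [Nat.even_iff] at hp <;> omega

theorem altPattern_snd_eq (r : ℕ) :
    (Finset.Icc 1 (2 * r)).filter (fun j => j % 4 = 2 ∨ j % 4 = 3) =
      (Finset.range r).image (fun i => if Even i then 2 * i + 2 else 2 * i + 1) := by
  ext x
  simp only [Finset.mem_filter, Finset.mem_Icc, Finset.mem_image, Finset.mem_range]
  constructor
  · rintro ⟨h, h'⟩
    refine ⟨(x - 1) / 2, by omega, ?_⟩
    split_ifs with hp <;> rw [Nat.even_iff] at hp <;> omega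
  · rintro ⟨i, hi, h⟩
    split_ifs at h with hp <;> rw [Nat.even_iff] at hp <;> omega

theorem sortedSeq_lt_of_image_eq {e f : Finset ℕ} {r : ℕ} (he : e.card = r) (hf : f.card = r)
    {φ : ℕ → ℕ} (hφ : StrictMonoOn φ (↑(e ∪ f) : Set ℕ))
    (hA : e.image φ = (Finset.Icc 1 (2 * r)).filter (fun j => j % 4 = 0 ∨ j % 4 = 1))
    (hB : f.image φ = (Finset.Icc 1 (2 * r)).filter (fun j => j % 4 = 2 ∨ j % 4 = 3)) :
    (∀ i j, i < j → j < r → sortedSeq e i < sortedSeq f j ∧ sortedSeq f i < sortedSeq e j) ∧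
      ∀ i < r, (Even i → sortedSeq e i < sortedSeq f i) ∧
        (¬ Even i → sortedSeq f i < sortedSeq e i) := by
  have hmono_e : StrictMonoOn φ e := hφ.mono (by simp)
  have hmono_f : StrictMonoOn φ f := hφ.mono (by simp)
  have ha : ∀ i < r, φ (sortedSeq e i) = if Even i then 2 * i + 1 else 2 * i + 2 := by
    intro i hi
    rw [← sortedSeq_image he hmono_e hi, hA, altPattern_fst_eq]
    refine sortedSeq_image_range (fun i j hij _ => ?_) hi
    split_ifs <;> omega
  have hb : ∀ i < r, φ (sortedSeq f i) = if Even i then 2 * i + 2 else 2 * i + 1 := by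
    intro i hi
    rw [← sortedSeq_image hf hmono_f hi, hB, altPattern_snd_eq]
    refine sortedSeq_image_range (fun i j hij _ => ?_) hi
    split_ifs <;> omega
  have me : ∀ i < r, sortedSeq e i ∈ (↑(e ∪ f) : Set ℕ) := fun i hi => by
    simpa using Or.inl (sortedSeq_mem (he ▸ hi))
  have mf : ∀ i < r, sortedSeq f i ∈ (↑(e ∪ f) : Set ℕ) := fun i hi => by
    simpa using Or.inr (sortedSeq_mem (hf ▸ hi))
  refine ⟨fun i j hij hj => ⟨?_, ?_⟩, fun i hi => ⟨fun hp => ?_, fun hp => ?_⟩⟩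
  · rw [← hφ.lt_iff_lt (me i (hij.trans hj)) (mf j hj), ha i (hij.trans hj), hb j hj]
    split_ifs <;> omega
  · rw [← hφ.lt_iff_lt (mf i (hij.trans hj)) (me j hj), hb i (hij.trans hj), ha j hj]
    split_ifs <;> omega
  · rw [← hφ.lt_iff_lt (me i hi) (mf i hi), ha i hi, hb i hi]
    simp [hp]
  · rw [← hφ.lt_iff_lt (mf i hi) (me i hi), ha i hi, hb i hi]
    simp [hp]

theorem FormsPattern.sortedSeq_lt {e f : Finset ℕ} {r : ℕ} (he : e.card = r) (hf : f.card = r)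
    (hr : 1 ≤ r) (h : FormsPattern e f (altPattern r)) :
    sortedSeq e 0 ≠ sortedSeq f 0 ∧ (sortedSeq e 0 < sortedSeq f 0 →
      (∀ i j, i < j → j < r → sortedSeq e i < sortedSeq f j ∧ sortedSeq f i < sortedSeq e j) ∧
      ∀ i < r, (Even i → sortedSeq e i < sortedSeq f i) ∧
        (¬ Even i → sortedSeq f i < sortedSeq e i)) := by
  obtain ⟨φ, hφ, hP⟩ := h
  have hP' := congrArg (fun s : Finset (Finset ℕ) => (s : Set (Finset ℕ))) hP
  simp only [altPattern, Finset.coe_insert, Finset.coe_singleton, Set.pair_eq_pair_iff] at hP'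
  rcases hP' with ⟨hA, hB⟩ | ⟨hB, hA⟩
  · have key := sortedSeq_lt_of_image_eq he hf hφ hA hB
    exact ⟨((key.2 0 hr).1 Even.zero).ne, fun _ => key⟩
  · have key := sortedSeq_lt_of_image_eq hf he (by rwa [Finset.union_comm]) hA hB
    have h0 := (key.2 0 hr).1 Even.zero
    exact ⟨h0.ne', fun h => absurd h h0.asymm⟩

theorem exists_enumeration {α : Type*} {S : Finset α} {key : α → ℕ}
    (hkey : Set.InjOn key S) {m : ℕ} (hm : m ≤ S.card) (a : α) :
    ∃ g : ℕ → α, (∀ k < m, g k ∈ S) ∧ ∀ k l, k < l → l < m → key (g k) < key (g l) := by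
  classical
  have hc : (S.image key).card = S.card := Finset.card_image_of_injOn hkey
  have hex : ∀ k, ∃ x, k < m → x ∈ S ∧ key x = sortedSeq (S.image key) k := by
    intro k
    by_cases hk : k < m
    · obtain ⟨x, hx, hx'⟩ := Finset.mem_image.1
        (sortedSeq_mem (e := S.image key) (i := k) (by omega))
      exact ⟨x, fun _ => ⟨hx, hx'⟩⟩
    · exact ⟨a, fun h => absurd h hk⟩
  choose g hg using hex
  refine ⟨g, fun k hk => (hg k hk).1, fun k l hkl hl => ?_⟩
  rw [(hg k (hkl.trans hl)).2, (hg l hl).2]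
  exact sortedSeq_lt hkl (by omega)

theorem exists_isAltGrid {r m : ℕ} (hr : 1 ≤ r) {M : Finset (Finset ℕ)}
    (hcard : M.card = m) (huni : ∀ e ∈ M, e.card = r)
    (hclique : IsPatternClique (altPattern r) M) :
    ∃ E, IsAltGrid r m E ∧ M = (Finset.range m).image fun k => (Finset.range r).image (E k) := by
  have hinj : Set.InjOn (fun e => sortedSeq e 0) (M : Set (Finset ℕ)) := by
    intro e he f hf hef
    by_contra hne
    exact ((hclique e he f hf hne).sortedSeq_lt (huni e he) (huni f hf) hr).1 hef
  obtain ⟨g, hgM, hg⟩ := exists_enumeration hinj hcard.ge ∅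
  have key : ∀ k l, k < l → l < m → _ := fun k l hkl hl =>
    ((hclique (g k) (hgM k (hkl.trans hl)) (g l) (hgM l hl)
      (fun h => (hg k l hkl hl).ne (by rw [h]))).sortedSeq_lt (huni _ (hgM k (hkl.trans hl)))
        (huni _ (hgM l hl)) hr).2 (hg k l hkl hl)
  refine ⟨fun k => sortedSeq (g k), ⟨fun k hk l hl i j hij hj => ?_, fun k l hkl hl =>
    (key k l hkl hl).2⟩, ?_⟩
  · rcases lt_trichotomy k l with h | rfl | h
    · exact ((key k l h hl).1 i j hij hj).1
    · exact sortedSeq_lt hij (by rwa [huni _ (hgM k hk)])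
    · exact ((key l k h hk).1 i j hij hj).2
  · have himg : ((Finset.range m).image fun k => (Finset.range r).image (sortedSeq (g k))) =
        (Finset.range m).image g :=
      Finset.image_congr fun k hk => image_sortedSeq (huni _ (hgM k (Finset.mem_range.1 hk)))
    rw [himg]
    symm
    apply Finset.eq_of_subset_of_card_le
    · intro x hx
      obtain ⟨k, hk, rfl⟩ := Finset.mem_image.1 hx
      exact hgM k (Finset.mem_range.1 hk)
    · rw [Finset.card_image_of_injOn, Finset.card_range, hcard]
      intro k hk l hl hkl
      have hk' := Finset.mem_range.1 hk
      have hl' := Finset.mem_range.1 hl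
      rcases lt_trichotomy k l with h | h | h
      · exact absurd (congrArg (fun e => sortedSeq e 0) hkl) (hg k l h hl').ne
      · exact h
      · exact absurd (congrArg (fun e => sortedSeq e 0) hkl) (hg l k h hk').ne'

theorem IsAltGrid.lt_of_lt {r m : ℕ} {E E' : ℕ → ℕ → ℕ} (hE : IsAltGrid r m E)
    (hE' : IsAltGrid r m E') {k l i j : ℕ} (hk : k < m) (hl : l < m) (hi : i < r) (hj : j < r)
    (h : E k i < E l j) : E' k i < E' l j := by
  rcases lt_trichotomy i j with hij | rfl | hij
  · exact hE'.1 k hk l hl i j hij hj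
  · rcases lt_trichotomy k l with hkl | rfl | hkl
    · by_cases hp : Even i
      · exact (hE'.2 k l hkl hl i hi).1 hp
      · exact absurd h ((hE.2 k l hkl hl i hi).2 hp).asymm
    · exact absurd h (lt_irrefl _)
    · by_cases hp : Even i
      · exact absurd h ((hE.2 l k hkl hk i hi).1 hp).asymm
      · exact (hE'.2 l k hkl hk i hi).2 hp
  · exact absurd h (hE.1 l hl k hk j i hij hi).asymm

theorem IsAltGrid.injective {r m : ℕ} {E : ℕ → ℕ → ℕ} (hE : IsAltGrid r m E) :
    Function.Injective fun p : Fin m × Fin r => E p.1 p.2 := by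
  rintro ⟨⟨k, hk⟩, ⟨i, hi⟩⟩ ⟨⟨l, hl⟩, ⟨j, hj⟩⟩ h
  dsimp only at h
  rcases lt_trichotomy i j with hij | rfl | hij
  · exact absurd h (hE.1 k hk l hl i j hij hj).ne
  · rcases lt_trichotomy k l with hkl | rfl | hkl
    · by_cases hp : Even i
      · exact absurd h ((hE.2 k l hkl hl i hi).1 hp).ne
      · exact absurd h ((hE.2 k l hkl hl i hi).2 hp).ne'
    · rfl
    · by_cases hp : Even i
      · exact absurd h ((hE.2 l k hkl hk i hi).1 hp).ne'
      · exact absurd h ((hE.2 l k hkl hk i hi).2 hp).ne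
  · exact absurd h (hE.1 l hl k hk j i hij hi).ne'

theorem IsAltGrid.mem_biUnion {r m : ℕ} {E : ℕ → ℕ → ℕ} {x : ℕ} :
    x ∈ ((Finset.range m).image fun k => (Finset.range r).image (E k)).biUnion id ↔
      ∃ k < m, ∃ i < r, E k i = x := by
  simp

theorem IsAltGrid.containsCopy {r m : ℕ} {E E' : ℕ → ℕ → ℕ} (hE : IsAltGrid r m E)
    (hE' : IsAltGrid r m E') {G : Finset (Finset ℕ)}
    (hG : ∀ k < m, (Finset.range r).image (E' k) ∈ G) :
    ContainsCopy G ((Finset.range m).image fun k => (Finset.range r).image (E k)) := by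
  set φ : ℕ → ℕ := Function.extend (fun p : Fin m × Fin r => E p.1 p.2)
    (fun p => E' p.1 p.2) 0 with hφ
  have hφE : ∀ k < m, ∀ i < r, φ (E k i) = E' k i := fun k hk i hi =>
    hE.injective.extend_apply (fun p => E' p.1 p.2) 0 (⟨k, hk⟩, ⟨i, hi⟩)
  refine ⟨φ, ?_, ?_⟩
  · intro x hx y hy hxy
    obtain ⟨k, hk, i, hi, rfl⟩ := IsAltGrid.mem_biUnion.1 (Finset.mem_coe.1 hx)
    obtain ⟨l, hl, j, hj, rfl⟩ := IsAltGrid.mem_biUnion.1 (Finset.mem_coe.1 hy)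
    rw [hφE k hk i hi, hφE l hl j hj]
    exact hE.lt_of_lt hE' hk hl hi hj hxy
  · intro e he
    obtain ⟨k, hk, rfl⟩ := Finset.mem_image.1 he
    have hk' := Finset.mem_range.1 hk
    have : ((Finset.range r).image (E k)).image φ = (Finset.range r).image (E' k) := by
      rw [Finset.image_image]
      exact Finset.image_congr fun i hi => hφE k hk' i (Finset.mem_range.1 hi)
    rw [this]
    exact hG k hk'

theorem IsAltGrid.comp {r m : ℕ} {E : ℕ → ℕ → ℕ} (hE : IsAltGrid r m E) {φ : ℕ → ℕ}
    (hφ : StrictMonoOn φ (↑(((Finset.range m).image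
      fun k => (Finset.range r).image (E k)).biUnion id) : Set ℕ)) :
    IsAltGrid r m fun k i => φ (E k i) := by
  have hmem : ∀ k < m, ∀ i < r, E k i ∈ (↑(((Finset.range m).image
      fun k => (Finset.range r).image (E k)).biUnion id) : Set ℕ) := fun k hk i hi =>
    Finset.mem_coe.2 (IsAltGrid.mem_biUnion.2 ⟨k, hk, i, hi, rfl⟩)
  refine ⟨fun k hk l hl i j hij hj => ?_, fun k l hkl hl i hi => ⟨fun hp => ?_, fun hp => ?_⟩⟩
  · exact hφ (hmem k hk i (hij.trans hj)) (hmem l hl j hj) (hE.1 k hk l hl i j hij hj)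
  · exact hφ (hmem k (hkl.trans hl) i hi) (hmem l hl i hi) ((hE.2 k l hkl hl i hi).1 hp)
  · exact hφ (hmem l hl i hi) (hmem k (hkl.trans hl) i hi) ((hE.2 k l hkl hl i hi).2 hp)

theorem IsAltGrid.add_le {r m : ℕ} {E : ℕ → ℕ → ℕ} (hE : IsAltGrid r m E) {i : ℕ} (hi : i < r)
    {k : ℕ} (hk : k < m) :
    (Even i → E 0 i + k ≤ E k i) ∧ (¬ Even i → E k i + k ≤ E 0 i) := by
  induction k with
  | zero => simp
  | succ k ih =>
    obtain ⟨h1, h2⟩ := ih (by omega)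
    obtain ⟨h3, h4⟩ := hE.2 k (k + 1) (by omega) hk i hi
    refine ⟨fun hp => ?_, fun hp => ?_⟩
    · have := h1 hp; have := h3 hp; omega
    · have := h2 hp; have := h4 hp; omega

theorem IsAltGrid.isShiftable {r n m : ℕ} (hr : 1 ≤ r) {E : ℕ → ℕ → ℕ} (hE : IsAltGrid r (m + 1) E)
    (hn : ∀ k < m + 1, ∀ i < r, E k i ≤ n) :
    IsShiftable r n m ((Finset.range r).image (E 0)) := by
  have hs : ∀ i < r, sortedSeq ((Finset.range r).image (E 0)) i = E 0 i := fun i hi =>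
    sortedSeq_image_range (fun i j hij hj => hE.1 0 (by omega) 0 (by omega) i j hij hj) hi
  refine ⟨fun i hp hi => ?_, fun hodd => ?_⟩
  · rw [hs i (by omega), hs (i + 1) hi]
    have h1 := (hE.add_le (i := i) (by omega) (Nat.lt_succ_self m)).1 hp
    have h2 := (hE.add_le hi (Nat.lt_succ_self m)).2 (by simpa [Nat.even_add_one] using hp)
    have h3 := hE.1 m (by omega) m (by omega) i (i + 1) (by omega) hi
    omega
  · rw [hs (r - 1) (by omega)]
    have hp : Even (r - 1) := by
      rw [Nat.odd_iff] at hodd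
      rw [Nat.even_iff]; omega
    have h1 := (hE.add_le (i := r - 1) (by omega) (Nat.lt_succ_self m)).1 hp
    have h2 := hn m (by omega) (r - 1) (by omega)
    omega

theorem isAltGrid_of_lineInvariant {r m : ℕ} {g : ℕ → Finset ℕ} {v : Fin r → ℕ}
    (hcard : ∀ k < m, (g k).card = r) (hv : ∀ k < m, lineInvariant r (g k) = v)
    (hg : ∀ k l, k < l → l < m → sortedSeq (g k) 0 < sortedSeq (g l) 0) :
    IsAltGrid r m fun k => sortedSeq (g k) := by
  have key : ∀ k l, k < l → l < m → ∀ i < r,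
      (Even i → sortedSeq (g k) i < sortedSeq (g l) i) ∧
        (¬ Even i → sortedSeq (g l) i < sortedSeq (g k) i) := by
    intro k l hkl hl i hi
    have h := congrFun ((hv k (hkl.trans hl)).trans (hv l hl).symm) ⟨i, hi⟩
    have h0 := hg k l hkl hl
    have h1 := sortedSeq_le (e := g k) (Nat.zero_le i) (by rw [hcard k (hkl.trans hl)]; exact hi)
    have h2 := sortedSeq_le (e := g l) (Nat.zero_le i) (by rw [hcard l hl]; exact hi)
    refine ⟨fun hp => ?_, fun hp => ?_⟩ <;>
    · simp only [lineInvariant, hp, if_true, if_false] at h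
      omega
  have key' : ∀ k l, k ≤ l → l < m → ∀ i < r,
      (Even i → sortedSeq (g k) i ≤ sortedSeq (g l) i) ∧
        (¬ Even i → sortedSeq (g l) i ≤ sortedSeq (g k) i) := by
    intro k l hkl hl i hi
    rcases hkl.eq_or_lt with rfl | hkl
    · exact ⟨fun _ => le_rfl, fun _ => le_rfl⟩
    · exact ⟨fun hp => ((key k l hkl hl i hi).1 hp).le, fun hp => ((key k l hkl hl i hi).2 hp).le⟩
  refine ⟨fun k hk l hl i j hij hj => ?_, key⟩
  have hlt : ∀ k < m, ∀ i j, i < j → j < r → sortedSeq (g k) i < sortedSeq (g k) j :=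
    fun k hk i j hij hj => sortedSeq_lt hij (by rwa [hcard k hk])
  have hle : ∀ k < m, ∀ i j, i ≤ j → j < r → sortedSeq (g k) i ≤ sortedSeq (g k) j :=
    fun k hk i j hij hj => sortedSeq_le hij (by rwa [hcard k hk])
  have hvia : sortedSeq (g k) i ≤ sortedSeq (g l) i ∨
      sortedSeq (g k) (i + 1) ≤ sortedSeq (g l) (i + 1) := by
    rcases le_total k l with h | h <;> by_cases hp : Even i
    · exact Or.inl ((key' k l h hl i (by omega)).1 hp)
    · exact Or.inr ((key' k l h hl (i + 1) (by omega)).1 (Nat.even_add_one.2 hp))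
    · exact Or.inr ((key' l k h hk (i + 1) (by omega)).2 (by simpa [Nat.even_add_one] using hp))
    · exact Or.inl ((key' l k h hk i (by omega)).2 hp)
  rcases hvia with h | h
  · exact h.trans_lt (hlt l hl i j hij hj)
  · exact ((hlt k hk i (i + 1) (by omega) (by omega)).trans_le h).trans_le
      (hle l hl (i + 1) j hij hj)

theorem image_range_mem_powersetCard {r n : ℕ} {a : ℕ → ℕ}
    (ha : ∀ i j, i < j → j < r → a i < a j) (hbd : ∀ i < r, 1 ≤ a i ∧ a i ≤ n) :
    (Finset.range r).image a ∈ (Finset.Icc 1 n).powersetCard r := by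
  refine Finset.mem_powersetCard.2 ⟨fun x hx => ?_, card_image_range_of_lt ha⟩
  obtain ⟨i, hi, rfl⟩ := Finset.mem_image.1 hx
  exact Finset.mem_Icc.2 (hbd i (Finset.mem_range.1 hi))

theorem sortedSeq_bounds {r n : ℕ} {e : Finset ℕ} (he : e ∈ (Finset.Icc 1 n).powersetCard r)
    {i : ℕ} (hi : i < r) : 1 ≤ sortedSeq e i ∧ sortedSeq e i ≤ n := by
  obtain ⟨h1, h2⟩ := Finset.mem_powersetCard.1 he
  exact Finset.mem_Icc.1 (h1 (sortedSeq_mem (h2 ▸ hi)))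

theorem lt_of_lt_succ_range {r : ℕ} {a : ℕ → ℕ} (ha : ∀ i, i + 1 < r → a i < a (i + 1))
    (i j : ℕ) (hij : i < j) (hj : j < r) : a i < a j := by
  induction j, hij using Nat.le_induction with
  | base => exact ha i hj
  | succ j hij ih => exact (ih (by omega)).trans (ha j hj)

theorem IsShiftable.altShift_lt {r n d k : ℕ} {e : Finset ℕ} (hs : IsShiftable r n d e)
    (he : e.card = r) (hk : k ≤ d) :
    ∀ i j, i < j → j < r → altShift (sortedSeq e) k i < altShift (sortedSeq e) k j := by
  refine lt_of_lt_succ_range fun i hi => ?_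
  have h := sortedSeq_lt (Nat.lt_add_one i) (by rw [he]; exact hi)
  by_cases hp : Even i
  · have h1 := hs.1 i hp hi
    simp only [altShift, hp, Nat.even_add_one, not_true, if_true, if_false]
    omega
  · simp only [altShift, hp, Nat.even_add_one, not_false_eq_true, if_true, if_false]
    omega

theorem IsShiftable.altShift_bounds {r n d k : ℕ} {e : Finset ℕ} (hs : IsShiftable r n d e)
    (he : e ∈ (Finset.Icc 1 n).powersetCard r) (hk : k ≤ d) {i : ℕ} (hi : i < r) :
    1 ≤ altShift (sortedSeq e) k i ∧ altShift (sortedSeq e) k i ≤ n := by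
  have hmono := hs.altShift_lt (Finset.mem_powersetCard.1 he).2 hk
  have h0 : 1 ≤ altShift (sortedSeq e) k 0 := by
    have := sortedSeq_bounds he (i := 0) (by omega)
    simp only [altShift, Even.zero, if_true]
    omega
  have hlast : altShift (sortedSeq e) k (r - 1) ≤ n := by
    have := sortedSeq_bounds he (i := r - 1) (by omega)
    by_cases hp : Even (r - 1)
    · have h2 := hs.2 (by rw [Nat.even_iff] at hp; rw [Nat.odd_iff]; omega)
      simp only [altShift, hp, if_true]
      omega
    · simp only [altShift, hp, if_false]
      omega
  constructor
  · rcases Nat.eq_zero_or_pos i with rfl | h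
    · exact h0
    · exact h0.trans (hmono 0 i h hi).le
  · rcases (Nat.le_sub_one_of_lt hi).eq_or_lt with rfl | h
    · exact hlast
    · exact (hmono i (r - 1) h (by omega)).le.trans hlast

theorem IsShiftable.lineInvariant_altShift {r n d k : ℕ} {e : Finset ℕ}
    (hs : IsShiftable r n d e) (he : e.card = r) (hk : k ≤ d) :
    lineInvariant r ((Finset.range r).image (altShift (sortedSeq e) k)) = lineInvariant r e := by
  funext ⟨i, hi⟩
  have hmono := hs.altShift_lt he hk
  have h0 : 0 < r := by omega
  by_cases hp : Even i
  · simp only [lineInvariant, sortedSeq_image_range hmono hi, sortedSeq_image_range hmono h0, hp,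
      altShift, if_true, Even.zero]
    omega
  · obtain ⟨j, rfl⟩ : ∃ j, i = j + 1 :=
      ⟨i - 1, by rw [Nat.even_iff] at hp; omega⟩
    have hj : Even j := by simpa [Nat.even_add_one] using hp
    have h1 := hs.1 j hj hi
    simp only [lineInvariant, sortedSeq_image_range hmono hi, sortedSeq_image_range hmono h0, hp,
      altShift, if_true, if_false, Even.zero]
    omega

theorem sortedSeq_zero_injOn_line {r n : ℕ} (v : Fin r → ℕ) :
    Set.InjOn (fun e => sortedSeq e 0)
      {e | e ∈ (Finset.Icc 1 n).powersetCard r ∧ lineInvariant r e = v} := by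
  rintro e ⟨he, hev⟩ f ⟨hf, hfv⟩ h
  have hec := (Finset.mem_powersetCard.1 he).2
  have hfc := (Finset.mem_powersetCard.1 hf).2
  refine sortedSeq_injOn hec hfc fun i hi => ?_
  have hv := congrFun (hev.trans hfv.symm) ⟨i, hi⟩
  have h1 := sortedSeq_le (e := e) (Nat.zero_le i) (by omega)
  have h2 := sortedSeq_le (e := f) (Nat.zero_le i) (by omega)
  dsimp only at h
  by_cases hp : Even i <;>
  · simp only [lineInvariant, hp, if_true, if_false] at hv
    omega

open Classical in
theorem card_line_le {r n d : ℕ} (hr : 1 ≤ r) {G : Finset (Finset ℕ)}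
    (hG : G ⊆ (Finset.Icc 1 n).powersetCard r)
    (hfree : ∀ E, IsAltGrid r (d + 1) E → ∃ k < d + 1, (Finset.range r).image (E k) ∉ G)
    (v : Fin r → ℕ) :
    (G.filter fun e => lineInvariant r e = v).card ≤
      ((((Finset.Icc 1 n).powersetCard r).filter fun e => ¬ IsShiftable r n d e).filter
        fun e => lineInvariant r e = v).card := by
  by_cases hne : ((((Finset.Icc 1 n).powersetCard r).filter fun e => IsShiftable r n d e).filter
      fun e => lineInvariant r e = v).Nonempty
  · obtain ⟨x, hx, hmax⟩ := Finset.exists_max_image _ (fun e => sortedSeq e 0) hne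
    simp only [Finset.mem_filter] at hx hmax
    obtain ⟨⟨hxV, hxs⟩, hxv⟩ := hx
    have hxc := (Finset.mem_powersetCard.1 hxV).2
    have hle : (G.filter fun e => lineInvariant r e = v).card ≤ d := by
      by_contra! hlt
      have hinj : Set.InjOn (fun e => sortedSeq e 0)
          (G.filter fun e => lineInvariant r e = v : Set (Finset ℕ)) := by
        refine (sortedSeq_zero_injOn_line (n := n) v).mono fun e he => ?_
        obtain ⟨h1, h2⟩ := Finset.mem_filter.1 (Finset.mem_coe.1 he)
        exact ⟨hG h1, h2⟩
      obtain ⟨g, hgG, hg⟩ := exists_enumeration hinj hlt ∅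
      have hgG' := fun k hk => Finset.mem_filter.1 (hgG k hk)
      have hgc : ∀ k < d + 1, (g k).card = r := fun k hk =>
        (Finset.mem_powersetCard.1 (hG (hgG' k hk).1)).2
      obtain ⟨k, hk, hk'⟩ := hfree _
        (isAltGrid_of_lineInvariant hgc (fun k hk => (hgG' k hk).2) hg)
      rw [image_sortedSeq (hgc k hk)] at hk'
      exact hk' (hgG' k hk).1
    refine hle.trans ?_
    have hmono : ∀ k < d, _ := fun k hk =>
      hxs.altShift_lt (k := k + 1) hxc (Nat.succ_le_of_lt hk)
    have hzero : ∀ k < d, sortedSeq ((Finset.range r).image (altShift (sortedSeq x) (k + 1))) 0 =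
        sortedSeq x 0 + (k + 1) := fun k hk => by
      rw [sortedSeq_image_range (hmono k hk) hr]
      simp [altShift]
    refine (Finset.card_range d).symm.le.trans (Finset.card_le_card_of_injOn
      (fun k => (Finset.range r).image (altShift (sortedSeq x) (k + 1))) ?_ ?_)
    · intro k hk
      have hk' : k < d := by simpa using hk
      have hV := image_range_mem_powersetCard (n := n) (hmono k hk') fun i hi =>
        hxs.altShift_bounds hxV (Nat.succ_le_of_lt hk') hi
      have hv := (hxs.lineInvariant_altShift hxc (Nat.succ_le_of_lt hk')).trans hxv
      simp only [Finset.coe_filter, Finset.mem_filter, Set.mem_ofPred_eq]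
      refine ⟨⟨hV, fun hsh => ?_⟩, hv⟩
      have := hmax _ ⟨⟨hV, hsh⟩, hv⟩
      rw [hzero k hk'] at this
      omega
    · intro k hk l hl hkl
      have h := congrArg (fun e => sortedSeq e 0) hkl
      simp only [hzero k (by simpa using hk), hzero l (by simpa using hl)] at h
      omega
  · refine Finset.card_le_card fun e he => ?_
    obtain ⟨h1, h2⟩ := Finset.mem_filter.1 he
    refine Finset.mem_filter.2 ⟨Finset.mem_filter.2 ⟨hG h1, fun hs => hne ⟨e, ?_⟩⟩, h2⟩
    exact Finset.mem_filter.2 ⟨Finset.mem_filter.2 ⟨hG h1, hs⟩, h2⟩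

open Classical in
theorem card_le_card_not_isShiftable {r n d : ℕ} (hr : 1 ≤ r) {G : Finset (Finset ℕ)}
    (hG : G ⊆ (Finset.Icc 1 n).powersetCard r)
    (hfree : ∀ E, IsAltGrid r (d + 1) E → ∃ k < d + 1, (Finset.range r).image (E k) ∉ G) :
    G.card ≤ (((Finset.Icc 1 n).powersetCard r).filter fun e => ¬ IsShiftable r n d e).card := by
  set V := (Finset.Icc 1 n).powersetCard r with hV
  rw [Finset.card_eq_sum_card_fiberwise (f := lineInvariant r) (t := V.image (lineInvariant r))
      (fun e he => Finset.mem_coe.2 (Finset.mem_image_of_mem _ (hG he))),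
    Finset.card_eq_sum_card_fiberwise (f := lineInvariant r) (t := V.image (lineInvariant r))
      (fun e he => Finset.mem_coe.2 (Finset.mem_image_of_mem _ (Finset.mem_filter.1 he).1))]
  exact Finset.sum_le_sum fun v _ => card_line_le hr hG hfree v

open Classical in
theorem card_isShiftable {r : ℕ} (hr : 1 ≤ r) (n d : ℕ) :
    (((Finset.Icc 1 n).powersetCard r).filter fun e => IsShiftable r n d e).card =
      (n - r * d).choose r := by
  obtain ⟨c, hc0, hceven, hcodd, hlast⟩ : ∃ c : ℕ → ℕ, c 0 = 0 ∧
      (∀ i, Even i → c (i + 1) = c i + 2 * d) ∧ (∀ i, ¬ Even i → c (i + 1) = c i) ∧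
      (if Odd r then c (r - 1) + d = r * d else c (r - 1) = r * d) := by
    refine ⟨fun i => 2 * d * ((i + 1) / 2), by simp, fun i hi => ?_, fun i hi => ?_, ?_⟩
    · have : (i + 1 + 1) / 2 = (i + 1) / 2 + 1 := by rw [Nat.even_iff] at hi; omega
      simp only [this]; ring
    · have : (i + 1 + 1) / 2 = (i + 1) / 2 := by rw [Nat.even_iff] at hi; omega
      simp only [this]
    · split_ifs with h
      · obtain ⟨t, rfl⟩ := h
        have : (2 * t + 1 - 1 + 1) / 2 = t := by omega
        simp only [this]; ring
      · obtain ⟨t, rfl⟩ := Nat.not_odd_iff_even.1 h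
        have : (t + t - 1 + 1) / 2 = t := by omega
        simp only [this]; ring
  have hcard : (n - r * d).choose r = ((Finset.Icc 1 (n - r * d)).powersetCard r).card := by
    simp
  have hfwd_pos : ∀ e ∈ ((Finset.Icc 1 n).powersetCard r), IsShiftable r n d e → ∀ i < r,
      c i < sortedSeq e i := by
    intro e he hs i
    induction i with
    | zero => intro hi; have := sortedSeq_bounds he hi; omega
    | succ i ih =>
      intro hi
      have h1 := ih (by omega)
      have h2 := sortedSeq_lt (e := e) (Nat.lt_add_one i)
        (by rw [(Finset.mem_powersetCard.1 he).2]; exact hi)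
      by_cases hp : Even i
      · have := hs.1 i hp hi; have := hceven i hp; omega
      · have := hcodd i hp; omega
  have hfwd_lt : ∀ e ∈ ((Finset.Icc 1 n).powersetCard r), IsShiftable r n d e →
      ∀ i j, i < j → j < r → sortedSeq e i - c i < sortedSeq e j - c j := by
    intro e he hs
    refine lt_of_lt_succ_range fun i hi => ?_
    have h1 := hfwd_pos e he hs i (by omega)
    have h2 := sortedSeq_lt (e := e) (Nat.lt_add_one i)
      (by rw [(Finset.mem_powersetCard.1 he).2]; exact hi)
    by_cases hp : Even i
    · have := hs.1 i hp hi; have := hceven i hp; omega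
    · have := hcodd i hp; omega
  have hbwd_lt : ∀ b : Finset ℕ, b.card = r →
      ∀ i j, i < j → j < r → sortedSeq b i + c i < sortedSeq b j + c j := by
    intro b hb
    refine lt_of_lt_succ_range fun i hi => ?_
    have h2 := sortedSeq_lt (e := b) (Nat.lt_add_one i) (by rw [hb]; exact hi)
    by_cases hp : Even i
    · have := hceven i hp; omega
    · have := hcodd i hp; omega
  rw [hcard]
  refine Finset.card_nbij' (fun e => (Finset.range r).image fun i => sortedSeq e i - c i)
    (fun b => (Finset.range r).image fun i => sortedSeq b i + c i) ?_ ?_ ?_ ?_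
  · intro e he
    obtain ⟨he, hs⟩ := Finset.mem_filter.1 (Finset.mem_coe.1 he)
    refine Finset.mem_coe.2 (image_range_mem_powersetCard (hfwd_lt e he hs) fun i hi => ⟨?_, ?_⟩)
    · have := hfwd_pos e he hs i hi; omega
    · have hle : sortedSeq e i - c i ≤ sortedSeq e (r - 1) - c (r - 1) := by
        rcases (Nat.le_sub_one_of_lt hi).eq_or_lt with h | h
        · rw [← h]
        · exact (hfwd_lt e he hs i (r - 1) h (by omega)).le
      have hb := sortedSeq_bounds he (i := r - 1) (by omega)
      have hpos := hfwd_pos e he hs (r - 1) (by omega)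
      split_ifs at hlast with hodd
      · have := hs.2 hodd; omega
      · omega
  · intro b hb
    have hb := Finset.mem_coe.1 hb
    have hbc := (Finset.mem_powersetCard.1 hb).2
    have hlt := hbwd_lt b hbc
    have hbl := sortedSeq_bounds hb (i := r - 1) (by omega)
    refine Finset.mem_coe.2 (Finset.mem_filter.2
      ⟨image_range_mem_powersetCard hlt fun i hi => ⟨?_, ?_⟩, fun i hp hi => ?_, fun hodd => ?_⟩)
    · have := sortedSeq_bounds hb hi; omega
    · have hle : sortedSeq b i + c i ≤ sortedSeq b (r - 1) + c (r - 1) := by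
        rcases (Nat.le_sub_one_of_lt hi).eq_or_lt with h | h
        · rw [← h]
        · exact (hlt i (r - 1) h (by omega)).le
      split_ifs at hlast <;> omega
    · rw [sortedSeq_image_range hlt hi, sortedSeq_image_range hlt (by omega), hceven i hp]
      have := sortedSeq_lt (e := b) (Nat.lt_add_one i) (by rw [hbc]; exact hi)
      omega
    · rw [sortedSeq_image_range hlt (by omega)]
      rw [if_pos hodd] at hlast
      omega
  · intro e he
    obtain ⟨he, hs⟩ := Finset.mem_filter.1 (Finset.mem_coe.1 he)
    refine Eq.trans (Finset.image_congr fun i hi => ?_)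
      (image_sortedSeq (Finset.mem_powersetCard.1 he).2)
    have hi' := Finset.mem_range.1 (Finset.mem_coe.1 hi)
    have := hfwd_pos e he hs i hi'
    dsimp only
    rw [sortedSeq_image_range (hfwd_lt e he hs) hi']
    omega
  · intro b hb
    have hbc := (Finset.mem_powersetCard.1 (Finset.mem_coe.1 hb)).2
    refine Eq.trans (Finset.image_congr fun i hi => ?_) (image_sortedSeq hbc)
    have hi' := Finset.mem_range.1 (Finset.mem_coe.1 hi)
    dsimp only
    rw [sortedSeq_image_range (hbwd_lt b hbc) hi']
    omega

theorem isOrderedGraph_iff {r n : ℕ} {G : Finset (Finset ℕ)} :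
    IsOrderedGraph r n G ↔ G ⊆ (Finset.Icc 1 n).powersetCard r := by
  simp only [IsOrderedGraph, Finset.subset_iff (s₁ := G), Finset.mem_powersetCard, and_comm]

/-- **Theorem 1.10(3).** Let `r, n, m ≥ 1` and let `P` be the alternating
`r`-pattern. Then `ex_<(n, P^(m)) = C(n,r) - C((n - r(m-1))₊, r)`, where
`P^(m)` is the (unique) `P`-clique with `m` edges, on the vertex set
`{1,…,rm}`. -/
theorem extremal_number_alternating_clique (r n m : ℕ) (hr : 1 ≤ r) (hn : 1 ≤ n) (hm : 1 ≤ m)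
    (M : Finset (Finset ℕ)) (hM : IsOrderedMatching r m M)
    (hclique : IsPatternClique (altPattern r) M) :
    exOrd r n M = n.choose r - (n - r * (m - 1)).choose r := by
  classical
  obtain ⟨d, rfl⟩ : ∃ d, m = d + 1 := ⟨m - 1, by omega⟩
  obtain ⟨E, hE, rfl⟩ := exists_isAltGrid hr hM.1 hM.2.1 hclique
  set V := (Finset.Icc 1 n).powersetCard r with hV
  have hcount : (V.filter fun e => ¬ IsShiftable r n d e).card =
      n.choose r - (n - r * (d + 1 - 1)).choose r := by
    have h1 := Finset.card_filter_add_card_filter_not (s := V) fun e => IsShiftable r n d e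
    have h2 : V.card = n.choose r := by simp [hV]
    rw [card_isShiftable hr] at h1
    rw [Nat.add_sub_cancel]
    omega
  rw [← hcount]
  refine IsGreatest.csSup_eq ⟨⟨_, ?_, ?_, rfl⟩, ?_⟩
  · exact isOrderedGraph_iff.2 (Finset.filter_subset _ _)
  · rintro ⟨φ, hφ, hmem⟩
    have hmem' : ∀ k < d + 1, (Finset.range r).image (fun i => φ (E k i)) ∈
        V.filter fun e => ¬ IsShiftable r n d e := by
      intro k hk
      have := hmem _ (Finset.mem_image_of_mem _ (Finset.mem_range.2 hk))
      rwa [Finset.image_image] at this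
    refine (Finset.mem_filter.1 (hmem' 0 (by omega))).2
      ((hE.comp hφ).isShiftable hr fun k hk i hi => ?_)
    have hsub := (Finset.mem_powersetCard.1 (Finset.mem_filter.1 (hmem' k hk)).1).1
    exact (Finset.mem_Icc.1 (hsub (Finset.mem_image_of_mem _ (Finset.mem_range.2 hi)))).2
  · rintro _ ⟨G, hG, hfree, rfl⟩
    refine card_le_card_not_isShiftable hr (isOrderedGraph_iff.1 hG) fun E' hE' => ?_
    by_contra! hall
    exact hfree (hE.containsCopy hE' hall)
end
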